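/- arXiv:1708.01923 — 8 statements merged into one kernel-verified Lean document; each statement's English description precedes it below -/
import Mathlib

section
/- Let s ∈ (0,1) and let F : ℝ³ → ℝ be continuous on ℝ³ \ {0}, even (F(−w) = F(w) for all w), and positively homogeneous of degree −2s. Let λ : ℝ² → ℝ³ be given by λ(t) = (1 − t₁ − t₂, t₁, t₂). Then the function (x,y) ↦ F(λ(x) − λ(y)) is Lebesgue-integrable on T × T and ∫_{T×T} F(λ(x) − λ(y)) d(x,y) = (2 / ((4−2s)(3−2s)(2−2s))) · ( ∫₀¹ F(−t, t−1, 1) dt + ∫₀¹ F(−1, 1−t, t) dt + ∫₀¹ F(t, −1, 1−t) dt ). (This is the Duffy-transformation identity underlying the stiffness-matrix contribution of a pair of identical triangular elements, equation (8) with c = 3, after integrating out the radial Duffy variables.) -/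
open MeasureTheory

namespace Duffy

/-- The reference triangle in the plane. -/
def triangle : Set (ℝ × ℝ) := {t | 0 ≤ t.1 ∧ 0 ≤ t.2 ∧ t.1 + t.2 ≤ 1}

/-- The gauge of the hexagon `triangle - triangle`. -/
def hexGauge (z : ℝ × ℝ) : ℝ := max 0 (-z.1) + max 0 (-z.2) + max 0 (z.1 + z.2)

lemma continuous_hexGauge : Continuous hexGauge := by
  unfold hexGauge
  fun_prop

lemma measurableSet_triangle : MeasurableSet triangle := by
  unfold triangle
  measurability

/-- The area of an isosceles right triangle with legs parallel to the axes. -/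
lemma volume_corner_triangle (a b d : ℝ) :
    volume {y : ℝ × ℝ | a ≤ y.1 ∧ b ≤ y.2 ∧ y.1 + y.2 ≤ d} =
      ENNReal.ofReal ((max 0 (d - a - b)) ^ 2 / 2) := by
  have hmeas : MeasurableSet {y : ℝ × ℝ | a ≤ y.1 ∧ b ≤ y.2 ∧ y.1 + y.2 ≤ d} := by
    measurability
  have hslice : ∀ x : ℝ, volume (Prod.mk x ⁻¹' {y : ℝ × ℝ | a ≤ y.1 ∧ b ≤ y.2 ∧ y.1 + y.2 ≤ d}) =
      (Set.Icc a (d - b)).indicator (fun x => ENNReal.ofReal (d - b - x)) x := by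
    intro x
    by_cases hx : x ∈ Set.Icc a (d - b)
    · have : Prod.mk x ⁻¹' {y : ℝ × ℝ | a ≤ y.1 ∧ b ≤ y.2 ∧ y.1 + y.2 ≤ d} =
          Set.Icc b (d - x) := by
        ext y
        simp only [Set.mem_preimage, Set.mem_ofPred_eq, Set.mem_Icc] at hx ⊢
        constructor <;> intro h <;> grind
      rw [this, Set.indicator_of_mem hx, Real.volume_Icc]
      congr 1
      ring
    · have : Prod.mk x ⁻¹' {y : ℝ × ℝ | a ≤ y.1 ∧ b ≤ y.2 ∧ y.1 + y.2 ≤ d} = ∅ := by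
        ext y
        simp only [Set.mem_preimage, Set.mem_ofPred_eq, Set.mem_Icc, Set.mem_empty_iff_false,
          iff_false] at hx ⊢
        grind
      rw [this, Set.indicator_of_notMem hx, measure_empty]
  rw [Measure.volume_eq_prod, Measure.prod_apply hmeas]
  simp_rw [hslice]
  rw [lintegral_indicator measurableSet_Icc]
  rcases le_total a (d - b) with h | h
  · rw [← ofReal_integral_eq_lintegral_ofReal]
    · rw [integral_Icc_eq_integral_Ioc, ← intervalIntegral.integral_of_le h,
        intervalIntegral.integral_sub (by simp) (by simp), integral_id,
        intervalIntegral.integral_const, max_eq_right (by linarith), smul_eq_mul]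
      congr 1
      ring
    · exact (by fun_prop : Continuous fun x : ℝ => d - b - x).integrableOn_Icc
    · filter_upwards [ae_restrict_mem measurableSet_Icc] with x hx
      simpa using hx.2
  · rw [max_eq_left (by linarith), setLIntegral_measure_zero _ _ (by simpa using h)]
    simp

lemma volume_triangle_inter_translate (z : ℝ × ℝ) :
    volume {y | z + y ∈ triangle ∧ y ∈ triangle} =
      ENNReal.ofReal ((max 0 (1 - hexGauge z)) ^ 2 / 2) := by
  have : {y | z + y ∈ triangle ∧ y ∈ triangle} = {y : ℝ × ℝ | max 0 (-z.1) ≤ y.1 ∧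
      max 0 (-z.2) ≤ y.2 ∧ y.1 + y.2 ≤ 1 - max 0 (z.1 + z.2)} := by
    ext y
    simp only [triangle, Set.mem_ofPred_eq, Prod.fst_add, Prod.snd_add]
    grind
  rw [this, volume_corner_triangle, hexGauge]
  congr 4
  ring

/-- Integrating a function of the difference over `triangle ×ˢ triangle`. -/
lemma lintegral_triangle_sub {k : ℝ × ℝ → ENNReal} (hk : Measurable k) :
    ∫⁻ p in triangle ×ˢ triangle, k (p.1 - p.2) =
      ∫⁻ z, k z * ENNReal.ofReal ((max 0 (1 - hexGauge z)) ^ 2 / 2) := by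
  have hT := measurableSet_triangle
  have hA : MeasurableSet {q : (ℝ × ℝ) × (ℝ × ℝ) | q.2 + q.1 ∈ triangle ∧ q.1 ∈ triangle} :=
    (measurable_snd.add measurable_fst hT).inter (measurable_fst hT)
  rw [← lintegral_indicator (hT.prod hT), Measure.volume_eq_prod, lintegral_prod_symm _ (by
    refine (Measurable.indicator ?_ (hT.prod hT)).aemeasurable
    fun_prop)]
  have hshift : ∀ y : ℝ × ℝ,
      ∫⁻ x, (triangle ×ˢ triangle).indicator (fun p => k (p.1 - p.2)) (x, y) =
      ∫⁻ z, {q : (ℝ × ℝ) × (ℝ × ℝ) | q.2 + q.1 ∈ triangle ∧ q.1 ∈ triangle}.indicator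
        (fun q => k q.2) (y, z) := by
    intro y
    rw [← lintegral_add_right_eq_self _ y]
    refine lintegral_congr fun x => ?_
    simp only [Set.indicator, Set.mem_ofPred_eq, add_sub_cancel_right]
    congr 1
  simp_rw [hshift]
  rw [lintegral_lintegral_swap (by
    refine (Measurable.indicator ?_ hA).aemeasurable
    fun_prop)]
  refine lintegral_congr fun z => ?_
  have hz : MeasurableSet {y | z + y ∈ triangle ∧ y ∈ triangle} :=
    (measurable_const_add z hT).inter hT
  rw [← volume_triangle_inter_translate, ← lintegral_indicator_const hz]
  refine lintegral_congr fun y => ?_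
  simp [Set.indicator]

/-- The point with radial coordinate `q.1` on the ray through `p + q.2 • d`. -/
def ray (p d q : ℝ × ℝ) : ℝ × ℝ := (q.1 * (p.1 + q.2 * d.1), q.1 * (p.2 + q.2 * d.2))

/-- The open cone spanned by the segment from `p` to `p + d`. -/
def cone (p d : ℝ × ℝ) : Set (ℝ × ℝ) := ray p d '' (Set.Ioi 0 ×ˢ Set.Ioo 0 1)

lemma mem_cone_iff {p d : ℝ × ℝ} {D : ℝ} (hD : D = p.1 * d.2 - p.2 * d.1) (hD2 : D * D = 1)
    (z : ℝ × ℝ) :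
    z ∈ cone p d ↔ 0 < D * (p.1 * z.2 - p.2 * z.1) ∧
      D * (p.1 * z.2 - p.2 * z.1) < D * (z.1 * d.2 - z.2 * d.1) := by
  constructor
  · rintro ⟨⟨r, t⟩, ⟨hr, ht0, ht1⟩, rfl⟩
    simp only [Set.mem_Ioi, ray] at hr ht0 ht1 ⊢
    have h1 : D * (p.1 * (r * (p.2 + t * d.2)) - p.2 * (r * (p.1 + t * d.1))) = r * t := by
      linear_combination (r * t) * hD2 - D * r * t * hD
    have h2 : D * (r * (p.1 + t * d.1) * d.2 - r * (p.2 + t * d.2) * d.1) = r := by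
      linear_combination r * hD2 - D * r * hD
    rw [h1, h2]
    exact ⟨mul_pos hr ht0, by nlinarith⟩
  · rintro ⟨h1, h2⟩
    set u := D * (p.1 * z.2 - p.2 * z.1) with hu
    set r := D * (z.1 * d.2 - z.2 * d.1) with hr
    have hr0 : 0 < r := h1.trans h2
    refine ⟨(r, u / r), ⟨hr0, div_pos h1 hr0, (div_lt_one hr0).2 h2⟩, ?_⟩
    have hmul : r * (u / r) = u := mul_div_cancel₀ u hr0.ne'
    simp only [ray]
    ext
    · simp only
      rw [mul_add, ← mul_assoc, hmul, hu, hr]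
      linear_combination z.1 * hD2 - D * z.1 * hD
    · simp only
      rw [mul_add, ← mul_assoc, hmul, hu, hr]
      linear_combination z.2 * hD2 - D * z.2 * hD

lemma hasFDerivAt_ray (p d q : ℝ × ℝ) :
    HasFDerivAt (ray p d) (Matrix.toLin (.finTwoProd ℝ) (.finTwoProd ℝ)
      !![p.1 + q.2 * d.1, q.1 * d.1; p.2 + q.2 * d.2, q.1 * d.2]).toContinuousLinearMap q := by
  rw [Matrix.toLin_finTwoProd_toContinuousLinearMap]
  have h : ∀ a b : ℝ, HasFDerivAt (fun q : ℝ × ℝ => q.1 * (a + q.2 * b))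
      ((a + q.2 * b) • ContinuousLinearMap.fst ℝ ℝ ℝ + (q.1 * b) • ContinuousLinearMap.snd ℝ ℝ ℝ)
      q := by
    intro a b
    convert! (hasFDerivAt_fst (𝕜 := ℝ) (p := q)).mul
      (((hasFDerivAt_snd (𝕜 := ℝ) (p := q)).mul_const b).const_add a) using 1
    ext <;> simp
  exact (h p.1 d.1).prodMk (h p.2 d.2)

lemma injOn_ray {p d : ℝ × ℝ} (hD : p.1 * d.2 - p.2 * d.1 ≠ 0) :
    Set.InjOn (ray p d) (Set.Ioi 0 ×ˢ Set.Ioo 0 1) := by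
  rintro ⟨r, t⟩ ⟨hr, -⟩ ⟨r', t'⟩ ⟨hr', -⟩ h
  simp only [ray, Prod.mk.injEq, Set.mem_Ioi] at h hr hr'
  obtain ⟨h1, h2⟩ := h
  have e1 : r = r' := mul_right_cancel₀ hD (by linear_combination d.2 * h1 - d.1 * h2)
  subst e1
  have e2 : r * t = r * t' := mul_right_cancel₀ hD (by linear_combination p.1 * h2 - p.2 * h1)
  rw [mul_left_cancel₀ hr.ne' e2]

lemma lintegral_cone {p d : ℝ × ℝ} (hD : |p.1 * d.2 - p.2 * d.1| = 1) (h : ℝ × ℝ → ENNReal) :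
    ∫⁻ z in cone p d, h z =
      ∫⁻ q in Set.Ioi 0 ×ˢ Set.Ioo 0 1, ENNReal.ofReal q.1 * h (ray p d q) := by
  have hm : MeasurableSet (Set.Ioi (0 : ℝ) ×ˢ Set.Ioo (0 : ℝ) 1) :=
    measurableSet_Ioi.prod measurableSet_Ioo
  have hD0 : p.1 * d.2 - p.2 * d.1 ≠ 0 := by
    intro h0
    simp [h0] at hD
  rw [cone, lintegral_image_eq_lintegral_abs_det_fderiv_mul volume hm
    (fun q _ => (hasFDerivAt_ray p d q).hasFDerivWithinAt) (injOn_ray hD0)]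
  refine setLIntegral_congr_fun hm fun q hq => ?_
  have hq1 : 0 < q.1 := hq.1
  simp only [LinearMap.det_toContinuousLinearMap, LinearMap.det_toLin, Matrix.det_fin_two_of]
  congr 2
  rw [show (p.1 + q.2 * d.1) * (q.1 * d.2) - q.1 * d.1 * (p.2 + q.2 * d.2) =
    q.1 * (p.1 * d.2 - p.2 * d.1) by ring, abs_mul, hD, abs_of_pos hq1, mul_one]

/-- The radial Beta integral. -/
lemma lintegral_radial {s : ℝ} (hs : s < 1) :
    ∫⁻ r in Set.Ioi (0 : ℝ),
      ENNReal.ofReal (r * r ^ (-(2 * s)) * ((max 0 (1 - r)) ^ 2 / 2)) =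
      ENNReal.ofReal (1 / ((4 - 2 * s) * (3 - 2 * s) * (2 - 2 * s))) := by
  have hsplit : ∫⁻ r in Set.Ioi (0 : ℝ),
      ENNReal.ofReal (r * r ^ (-(2 * s)) * ((max 0 (1 - r)) ^ 2 / 2)) =
      ∫⁻ r in Set.Ioc (0 : ℝ) 1, ENNReal.ofReal
        ((1 / 2) * r ^ (1 - 2 * s) - r ^ (2 - 2 * s) + (1 / 2) * r ^ (3 - 2 * s)) := by
    rw [← lintegral_indicator measurableSet_Ioi, ← lintegral_indicator measurableSet_Ioc]
    refine lintegral_congr fun r => ?_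
    by_cases h0 : 0 < r
    · by_cases h1 : r ≤ 1
      · rw [Set.indicator_of_mem (Set.mem_Ioi.2 h0), Set.indicator_of_mem (Set.mem_Ioc.2 ⟨h0, h1⟩),
          max_eq_right (by linarith), show 1 - 2 * s = -(2 * s) + 1 by ring,
          show 2 - 2 * s = -(2 * s) + 1 + 1 by ring, show 3 - 2 * s = -(2 * s) + 1 + 1 + 1 by ring]
        simp only [Real.rpow_add_one h0.ne']
        congr 1
        ring
      · rw [Set.indicator_of_mem (Set.mem_Ioi.2 h0),
          Set.indicator_of_notMem (fun h => h1 h.2), max_eq_left (by linarith)]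
        simp
    · rw [Set.indicator_of_notMem (mt Set.mem_Ioi.1 h0), Set.indicator_of_notMem (fun h => h0 h.1)]
  have i1 : IntervalIntegrable (fun r : ℝ => (1 / 2) * r ^ (1 - 2 * s)) volume 0 1 :=
    (intervalIntegral.intervalIntegrable_rpow' (by linarith)).const_mul _
  have i2 : IntervalIntegrable (fun r : ℝ => r ^ (2 - 2 * s)) volume 0 1 :=
    intervalIntegral.intervalIntegrable_rpow' (by linarith)
  have i3 : IntervalIntegrable (fun r : ℝ => (1 / 2) * r ^ (3 - 2 * s)) volume 0 1 :=
    (intervalIntegral.intervalIntegrable_rpow' (by linarith)).const_mul _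
  rw [hsplit, ← ofReal_integral_eq_lintegral_ofReal]
  · rw [← intervalIntegral.integral_of_le zero_le_one, intervalIntegral.integral_add (i1.sub i2) i3,
      intervalIntegral.integral_sub i1 i2, intervalIntegral.integral_const_mul,
      intervalIntegral.integral_const_mul, integral_rpow (Or.inl (by linarith)),
      integral_rpow (Or.inl (by linarith)), integral_rpow (Or.inl (by linarith))]
    rw [Real.zero_rpow (by linarith), Real.zero_rpow (by linarith), Real.zero_rpow (by linarith)]
    simp only [Real.one_rpow]
    congr 1
    have h1 : 1 - s ≠ 0 := by linarith
    have h2 : 2 - 2 * s ≠ 0 := by linarith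
    have h3 : 3 - 2 * s ≠ 0 := by linarith
    have h4 : 4 - 2 * s ≠ 0 := by linarith
    rw [show 1 - 2 * s + 1 = 2 - 2 * s by ring, show 2 - 2 * s + 1 = 3 - 2 * s by ring,
      show 3 - 2 * s + 1 = 4 - 2 * s by ring]
    field_simp
    ring
  · exact (intervalIntegrable_iff_integrableOn_Ioc_of_le zero_le_one).1 ((i1.sub i2).add i3)
  · filter_upwards [ae_restrict_mem measurableSet_Ioc] with r hr
    have h0 := hr.1
    rw [show 1 - 2 * s = -(2 * s) + 1 by ring,
          show 2 - 2 * s = -(2 * s) + 1 + 1 by ring, show 3 - 2 * s = -(2 * s) + 1 + 1 + 1 by ring]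
    simp only [Real.rpow_add_one h0.ne']
    have := Real.rpow_nonneg h0.le (-(2 * s))
    have : 0 ≤ r ^ (-(2 * s)) * r * (1 - r) ^ 2 / 2 := by positivity
    simp only [Pi.zero_apply]
    linarith

/-- The contribution of one cone over an edge of the hexagon. -/
lemma lintegral_edge_cone {s : ℝ} (hs : s < 1) {G : ℝ × ℝ → ℝ}
    (hhom : ∀ c : ℝ, 0 < c → ∀ z, G (c • z) = c ^ (-(2 * s)) * G z)
    {p d : ℝ × ℝ} (hD : |p.1 * d.2 - p.2 * d.1| = 1)
    (hedge : ∀ t ∈ Set.Ioo (0 : ℝ) 1, ∀ r > 0, hexGauge (ray p d (r, t)) = r)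
    (hG : ContinuousOn (fun t : ℝ => G (p + t • d)) (Set.Icc 0 1)) (hpos : ∀ z, 0 ≤ G z) :
    ∫⁻ z in cone p d,
      ENNReal.ofReal (G z) * ENNReal.ofReal ((max 0 (1 - hexGauge z)) ^ 2 / 2) =
      ENNReal.ofReal (1 / ((4 - 2 * s) * (3 - 2 * s) * (2 - 2 * s)) *
        ∫ t in (0 : ℝ)..1, G (p + t • d)) := by
  have hm : MeasurableSet (Set.Ioi (0 : ℝ) ×ˢ Set.Ioo (0 : ℝ) 1) :=
    measurableSet_Ioi.prod measurableSet_Ioo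
  rw [lintegral_cone hD]
  have hfac : ∫⁻ q in Set.Ioi 0 ×ˢ Set.Ioo 0 1, ENNReal.ofReal q.1 *
      (ENNReal.ofReal (G (ray p d q)) *
        ENNReal.ofReal ((max 0 (1 - hexGauge (ray p d q))) ^ 2 / 2)) =
      ∫⁻ q in Set.Ioi (0 : ℝ) ×ˢ Set.Ioo (0 : ℝ) 1,
        ENNReal.ofReal (q.1 * q.1 ^ (-(2 * s)) * ((max 0 (1 - q.1)) ^ 2 / 2)) *
        ENNReal.ofReal (G (p + q.2 • d)) := by
    refine setLIntegral_congr_fun hm ?_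
    rintro ⟨r, t⟩ ⟨hr, ht⟩
    simp only [Set.mem_Ioi] at hr ht ⊢
    have hray : ray p d (r, t) = r • (p + t • d) := by
      ext <;> simp [ray, mul_add]
    rw [hedge t ht r hr, hray, hhom r hr, ← ENNReal.ofReal_mul (by positivity [hpos (p + t • d)]),
      ← ENNReal.ofReal_mul hr.le, ← ENNReal.ofReal_mul (by positivity)]
    congr 1
    ring
  have hI : IntegrableOn (fun t : ℝ => G (p + t • d)) (Set.Ioo 0 1) :=
    (hG.integrableOn_Icc).mono_set Set.Ioo_subset_Icc_self
  rw [hfac, Measure.volume_eq_prod, ← Measure.prod_restrict, lintegral_prod_mul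
    (f := fun r : ℝ => ENNReal.ofReal (r * r ^ (-(2 * s)) * ((max 0 (1 - r)) ^ 2 / 2)))
    (g := fun t : ℝ => ENNReal.ofReal (G (p + t • d)))
    (by fun_prop) hI.aestronglyMeasurable.aemeasurable.ennreal_ofReal,
    lintegral_radial hs, ← ofReal_integral_eq_lintegral_ofReal hI
      (Filter.Eventually.of_forall fun t => hpos _),
    ← integral_Ioc_eq_integral_Ioo, ← intervalIntegral.integral_of_le zero_le_one,
    ENNReal.ofReal_mul]
  have h2 : 0 < 2 - 2 * s := by linarith
  have h3 : 0 < 3 - 2 * s := by linarith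
  have h4 : 0 < 4 - 2 * s := by linarith
  positivity

/-- The cone over an edge and its reflection contribute equally for an even function. -/
lemma lintegral_neg_cone {p d : ℝ × ℝ} (hD : |p.1 * d.2 - p.2 * d.1| = 1)
    {h : ℝ × ℝ → ENNReal} (heven : ∀ z, h (-z) = h z) :
    ∫⁻ z in cone (-p) (-d), h z = ∫⁻ z in cone p d, h z := by
  rw [lintegral_cone hD, lintegral_cone (by simpa using hD)]
  refine lintegral_congr fun q => ?_
  rw [← heven (ray p d q)]
  congr 2
  ext <;> simp [ray] <;> ring

lemma measurableSet_cone {p d : ℝ × ℝ} {D : ℝ} (hD : D = p.1 * d.2 - p.2 * d.1)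
    (hD2 : D * D = 1) : MeasurableSet (cone p d) := by
  have : cone p d = {z | 0 < D * (p.1 * z.2 - p.2 * z.1)} ∩
      {z | D * (p.1 * z.2 - p.2 * z.1) < D * (z.1 * d.2 - z.2 * d.1)} :=
    Set.ext (mem_cone_iff hD hD2)
  rw [this]
  exact (measurableSet_lt (by fun_prop) (by fun_prop)).inter
    (measurableSet_lt (by fun_prop) (by fun_prop))

lemma ae_linear_ne_zero {L : ℝ × ℝ →ₗ[ℝ] ℝ} (hL : L ≠ 0) : ∀ᵐ z : ℝ × ℝ, L z ≠ 0 := by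
  have : (volume : Measure (ℝ × ℝ)) (LinearMap.ker L : Set (ℝ × ℝ)) = 0 :=
    Measure.addHaar_submodule volume _ (by rwa [Ne, LinearMap.ker_eq_top])
  rw [ae_iff]
  convert! this using 2
  ext z
  simp

/-- The integral of an even function over the plane, split along the edges of the hexagon. -/
lemma lintegral_eq_sum_cones {h : ℝ × ℝ → ENNReal} (hm : Measurable h)
    (heven : ∀ z, h (-z) = h z) :
    ∫⁻ z, h z = 2 * ((∫⁻ z in cone (-1, 1) (1, 0), h z) + (∫⁻ z in cone (1, 0) (-1, 1), h z) +
      ∫⁻ z in cone (-1, 1) (0, -1), h z) := by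
  have mB : MeasurableSet (cone (-1, 1) (1, 0)) :=
    measurableSet_cone (D := -1) (by norm_num) (by norm_num)
  have mA : MeasurableSet (cone (1, 0) (-1, 1)) :=
    measurableSet_cone (D := 1) (by norm_num) (by norm_num)
  have mC : MeasurableSet (cone (-1, 1) (0, -1)) :=
    measurableSet_cone (D := 1) (by norm_num) (by norm_num)
  have mB' : MeasurableSet (cone (-(-1, 1)) (-(1, 0))) :=
    measurableSet_cone (D := -1) (by norm_num) (by norm_num)
  have mA' : MeasurableSet (cone (-(1, 0)) (-(-1, 1))) :=
    measurableSet_cone (D := 1) (by norm_num) (by norm_num)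
  have mC' : MeasurableSet (cone (-(-1, 1)) (-(0, -1))) :=
    measurableSet_cone (D := 1) (by norm_num) (by norm_num)
  have hsum : ∫⁻ z, h z = ∫⁻ z, ((cone (-1, 1) (1, 0)).indicator h z +
      (cone (1, 0) (-1, 1)).indicator h z + (cone (-1, 1) (0, -1)).indicator h z +
      (cone (-(-1, 1)) (-(1, 0))).indicator h z + (cone (-(1, 0)) (-(-1, 1))).indicator h z +
      (cone (-(-1, 1)) (-(0, -1))).indicator h z) := by
    have n1 : ∀ᵐ z : ℝ × ℝ, z.1 ≠ 0 := ae_linear_ne_zero (L := LinearMap.fst ℝ ℝ ℝ) fun h => by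
      simpa using LinearMap.congr_fun h (1, 0)
    have n2 : ∀ᵐ z : ℝ × ℝ, z.2 ≠ 0 := ae_linear_ne_zero (L := LinearMap.snd ℝ ℝ ℝ) fun h => by
      simpa using LinearMap.congr_fun h (0, 1)
    have n3 : ∀ᵐ z : ℝ × ℝ, z.1 + z.2 ≠ 0 :=
      ae_linear_ne_zero (L := LinearMap.fst ℝ ℝ ℝ + LinearMap.snd ℝ ℝ ℝ) fun h => by
        simpa using LinearMap.congr_fun h (1, 0)
    refine lintegral_congr_ae ?_
    filter_upwards [n1, n2, n3] with z h1 h2 h3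
    have eB : z ∈ cone (-1, 1) (1, 0) ↔ z.1 < 0 ∧ 0 < z.1 + z.2 := by
      rw [mem_cone_iff (D := -1) (by norm_num) (by norm_num)]
      norm_num
      constructor <;> rintro ⟨h, h'⟩ <;> constructor <;> linarith
    have eA : z ∈ cone (1, 0) (-1, 1) ↔ 0 < z.1 ∧ 0 < z.2 := by
      rw [mem_cone_iff (D := 1) (by norm_num) (by norm_num)]
      norm_num
      constructor <;> rintro ⟨h, h'⟩ <;> constructor <;> linarith
    have eC : z ∈ cone (-1, 1) (0, -1) ↔ 0 < z.2 ∧ z.1 + z.2 < 0 := by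
      rw [mem_cone_iff (D := 1) (by norm_num) (by norm_num)]
      norm_num
      constructor <;> rintro ⟨h, h'⟩ <;> constructor <;> linarith
    have eB' : z ∈ cone (-(-1, 1)) (-(1, 0)) ↔ 0 < z.1 ∧ z.1 + z.2 < 0 := by
      rw [mem_cone_iff (D := -1) (by norm_num) (by norm_num)]
      norm_num
      constructor <;> rintro ⟨h, h'⟩ <;> constructor <;> linarith
    have eA' : z ∈ cone (-(1, 0)) (-(-1, 1)) ↔ z.1 < 0 ∧ z.2 < 0 := by
      rw [mem_cone_iff (D := 1) (by norm_num) (by norm_num)]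
      norm_num
      constructor <;> rintro ⟨h, h'⟩ <;> constructor <;> linarith
    have eC' : z ∈ cone (-(-1, 1)) (-(0, -1)) ↔ z.2 < 0 ∧ 0 < z.1 + z.2 := by
      rw [mem_cone_iff (D := 1) (by norm_num) (by norm_num)]
      norm_num
      constructor <;> rintro ⟨h, h'⟩ <;> constructor <;> linarith
    simp only [Set.indicator, eA, eB, eC, eA', eB', eC']
    rcases lt_or_gt_of_ne h1 with h1 | h1 <;> rcases lt_or_gt_of_ne h2 with h2 | h2 <;>
      rcases lt_or_gt_of_ne h3 with h3 | h3 <;> first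
      | (exfalso; linarith)
      | simp [h1, h2, h3, h1.not_gt, h2.not_gt, h3.not_gt]
  rw [hsum, lintegral_add_right _ (hm.indicator mC'), lintegral_add_right _ (hm.indicator mA'),
    lintegral_add_right _ (hm.indicator mB'), lintegral_add_right _ (hm.indicator mC),
    lintegral_add_right _ (hm.indicator mA), lintegral_indicator mA, lintegral_indicator mB,
    lintegral_indicator mC, lintegral_indicator mA', lintegral_indicator mB',
    lintegral_indicator mC', lintegral_neg_cone (by norm_num) heven,
    lintegral_neg_cone (by norm_num) heven, lintegral_neg_cone (by norm_num) heven]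
  ring

lemma hexGauge_neg (z : ℝ × ℝ) : hexGauge (-z) = hexGauge z := by
  simp only [hexGauge, Prod.fst_neg, Prod.snd_neg]
  grind

lemma continuousOn_edge {G : ℝ × ℝ → ℝ} (hcont : ContinuousOn G {0}ᶜ) {p d : ℝ × ℝ}
    (hD : p.1 * d.2 - p.2 * d.1 ≠ 0) (S : Set ℝ) :
    ContinuousOn (fun t : ℝ => G (p + t • d)) S := by
  refine hcont.comp (by fun_prop) fun t _ h0 => hD ?_
  have h1 : p.1 + t * d.1 = 0 := congrArg Prod.fst h0
  have h2 : p.2 + t * d.2 = 0 := congrArg Prod.snd h0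
  linear_combination d.2 * h1 - d.1 * h2

/-- The nonnegative case of the Duffy identity, as a lower Lebesgue integral. -/
lemma lintegral_triangle_sub_of_homogeneous {s : ℝ} (hs : s < 1) {G : ℝ × ℝ → ℝ}
    (hcont : ContinuousOn G {0}ᶜ) (heven : ∀ z, G (-z) = G z)
    (hhom : ∀ c : ℝ, 0 < c → ∀ z, G (c • z) = c ^ (-(2 * s)) * G z) (hpos : ∀ z, 0 ≤ G z) :
    ∫⁻ p in triangle ×ˢ triangle, ENNReal.ofReal (G (p.1 - p.2)) =
      ENNReal.ofReal ((2 / ((4 - 2 * s) * (3 - 2 * s) * (2 - 2 * s))) *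
        ((∫ t in (0 : ℝ)..1, G ((-1, 1) + t • (1, 0))) +
         (∫ t in (0 : ℝ)..1, G ((1, 0) + t • (-1, 1))) +
         (∫ t in (0 : ℝ)..1, G ((-1, 1) + t • (0, -1))))) := by
  have hGm : Measurable G := measurable_of_continuousOn_compl_singleton 0 hcont
  have hgm := continuous_hexGauge.measurable
  have h2 : 0 < 2 - 2 * s := by linarith
  have h3 : 0 < 3 - 2 * s := by linarith
  have h4 : 0 < 4 - 2 * s := by linarith
  have hedge_nonneg : ∀ p d : ℝ × ℝ, 0 ≤ ∫ t in (0 : ℝ)..1, G (p + t • d) := fun p d =>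
    intervalIntegral.integral_nonneg zero_le_one fun t _ => hpos _
  rw [lintegral_triangle_sub (k := fun z => ENNReal.ofReal (G z)) (by fun_prop),
    lintegral_eq_sum_cones (by fun_prop) (fun z => by simp only [heven, hexGauge_neg])]
  have edge : ∀ p d : ℝ × ℝ, |p.1 * d.2 - p.2 * d.1| = 1 →
      (∀ t ∈ Set.Ioo (0 : ℝ) 1, ∀ r > 0, hexGauge (ray p d (r, t)) = r) →
      ∫⁻ z in cone p d,
        ENNReal.ofReal (G z) * ENNReal.ofReal ((max 0 (1 - hexGauge z)) ^ 2 / 2) =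
      ENNReal.ofReal (1 / ((4 - 2 * s) * (3 - 2 * s) * (2 - 2 * s)) *
        ∫ t in (0 : ℝ)..1, G (p + t • d)) := fun p d hD hedge =>
    lintegral_edge_cone hs hhom hD hedge
      (continuousOn_edge hcont (fun h0 => by simp [h0] at hD) _) hpos
  rw [edge (-1, 1) (1, 0) (by norm_num), edge (1, 0) (-1, 1) (by norm_num),
    edge (-1, 1) (0, -1) (by norm_num)]
  · have c0 : 0 ≤ 1 / ((4 - 2 * s) * (3 - 2 * s) * (2 - 2 * s)) := by positivity
    rw [← ENNReal.ofReal_add (mul_nonneg c0 (hedge_nonneg _ _)) (mul_nonneg c0 (hedge_nonneg _ _)),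
      ← ENNReal.ofReal_add (add_nonneg (mul_nonneg c0 (hedge_nonneg _ _)) (mul_nonneg c0 (hedge_nonneg _ _)))
        (mul_nonneg c0 (hedge_nonneg _ _)), ← ENNReal.ofReal_ofNat 2, ← ENNReal.ofReal_mul zero_le_two]
    congr 1
    ring
  all_goals
    intro t ht r hr
    have hv0 : 0 < r * t := mul_pos hr ht.1
    have hv1 : r * t < r := by nlinarith [ht.2]
    simp only [ray, hexGauge, max_def]
    split_ifs <;> nlinarith

/-- The Duffy identity in barycentric difference coordinates, for nonnegative kernels. -/
lemma integral_triangle_sub_of_nonneg {s : ℝ} (hs : s < 1) {G : ℝ × ℝ → ℝ}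
    (hcont : ContinuousOn G {0}ᶜ) (heven : ∀ z, G (-z) = G z)
    (hhom : ∀ c : ℝ, 0 < c → ∀ z, G (c • z) = c ^ (-(2 * s)) * G z) (hpos : ∀ z, 0 ≤ G z) :
    IntegrableOn (fun p : (ℝ × ℝ) × (ℝ × ℝ) => G (p.1 - p.2)) (triangle ×ˢ triangle) ∧
    ∫ p in triangle ×ˢ triangle, G (p.1 - p.2) =
      (2 / ((4 - 2 * s) * (3 - 2 * s) * (2 - 2 * s))) *
        ((∫ t in (0 : ℝ)..1, G ((-1, 1) + t • (1, 0))) +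
         (∫ t in (0 : ℝ)..1, G ((1, 0) + t • (-1, 1))) +
         (∫ t in (0 : ℝ)..1, G ((-1, 1) + t • (0, -1)))) := by
  have hGm : Measurable G := measurable_of_continuousOn_compl_singleton 0 hcont
  have hmeas : Measurable fun p : (ℝ × ℝ) × (ℝ × ℝ) => G (p.1 - p.2) := by fun_prop
  have hl := lintegral_triangle_sub_of_homogeneous hs hcont heven hhom hpos
  have h2 : 0 < 2 - 2 * s := by linarith
  have h3 : 0 < 3 - 2 * s := by linarith
  have h4 : 0 < 4 - 2 * s := by linarith
  have hedge_nonneg : ∀ p d : ℝ × ℝ, 0 ≤ ∫ t in (0 : ℝ)..1, G (p + t • d) := fun p d =>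
    intervalIntegral.integral_nonneg zero_le_one fun t _ => hpos _
  refine ⟨⟨hmeas.aestronglyMeasurable, ?_⟩, ?_⟩
  · rw [hasFiniteIntegral_iff_ofReal (Filter.Eventually.of_forall fun p => hpos _), hl]
    exact ENNReal.ofReal_lt_top
  · rw [integral_eq_lintegral_of_nonneg_ae (Filter.Eventually.of_forall fun p => hpos _)
      hmeas.aestronglyMeasurable, hl, ENNReal.toReal_ofReal]
    exact mul_nonneg (by positivity)
      (add_nonneg (add_nonneg (hedge_nonneg _ _) (hedge_nonneg _ _)) (hedge_nonneg _ _))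

/-- The Duffy identity in barycentric difference coordinates. -/
lemma integral_triangle_sub {s : ℝ} (hs : s < 1) {G : ℝ × ℝ → ℝ}
    (hcont : ContinuousOn G {0}ᶜ) (heven : ∀ z, G (-z) = G z)
    (hhom : ∀ c : ℝ, 0 < c → ∀ z, G (c • z) = c ^ (-(2 * s)) * G z) :
    IntegrableOn (fun p : (ℝ × ℝ) × (ℝ × ℝ) => G (p.1 - p.2)) (triangle ×ˢ triangle) ∧
    ∫ p in triangle ×ˢ triangle, G (p.1 - p.2) =
      (2 / ((4 - 2 * s) * (3 - 2 * s) * (2 - 2 * s))) *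
        ((∫ t in (0 : ℝ)..1, G ((-1, 1) + t • (1, 0))) +
         (∫ t in (0 : ℝ)..1, G ((1, 0) + t • (-1, 1))) +
         (∫ t in (0 : ℝ)..1, G ((-1, 1) + t • (0, -1)))) := by
  have cP : ContinuousOn (fun z => max (G z) 0) {0}ᶜ := hcont.sup continuousOn_const
  have cN : ContinuousOn (fun z => max (-G z) 0) {0}ᶜ := hcont.neg.sup continuousOn_const
  obtain ⟨iP, eP⟩ := integral_triangle_sub_of_nonneg hs cP (fun z => by rw [heven])
    (fun c hc z => by
      rw [hhom c hc, mul_max_of_nonneg _ _ (Real.rpow_nonneg hc.le _), mul_zero])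
    (fun z => le_max_right _ _)
  obtain ⟨iN, eN⟩ := integral_triangle_sub_of_nonneg hs cN (fun z => by rw [heven])
    (fun c hc z => by
      rw [hhom c hc, mul_max_of_nonneg _ _ (Real.rpow_nonneg hc.le _), mul_zero, mul_neg])
    (fun z => le_max_right _ _)
  have hsub : ∀ z, G z = max (G z) 0 - max (-G z) 0 := fun z => by grind
  have edge : ∀ p d : ℝ × ℝ, p.1 * d.2 - p.2 * d.1 ≠ 0 →
      ∫ t in (0 : ℝ)..1, G (p + t • d) = (∫ t in (0 : ℝ)..1, max (G (p + t • d)) 0) -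
        ∫ t in (0 : ℝ)..1, max (-G (p + t • d)) 0 := by
    intro p d hD
    rw [← intervalIntegral.integral_sub (continuousOn_edge cP hD _).intervalIntegrable
      (continuousOn_edge cN hD _).intervalIntegrable]
    exact intervalIntegral.integral_congr fun t _ => hsub _
  have hfun : (fun p : (ℝ × ℝ) × (ℝ × ℝ) => G (p.1 - p.2)) =
      fun p => max (G (p.1 - p.2)) 0 - max (-G (p.1 - p.2)) 0 := funext fun p => hsub _
  rw [hfun]
  refine ⟨iP.sub iN, ?_⟩
  rw [integral_sub iP iN, eP, eN, edge (-1, 1) (1, 0) (by norm_num),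
    edge (1, 0) (-1, 1) (by norm_num), edge (-1, 1) (0, -1) (by norm_num)]
  ring

end Duffy

/-- Duffy-transformation identity for a pair of identical triangular elements
(equation (8) with c = 3, radial Duffy variables integrated out). -/
theorem duffy_identical_elements (s : ℝ) (hs : s ∈ Set.Ioo (0:ℝ) 1)
    (F : ℝ × ℝ × ℝ → ℝ)
    (hFcont : ContinuousOn F {w | w ≠ 0})
    (hFeven : ∀ w, F (-w) = F w)
    (hFhom : ∀ c : ℝ, 0 < c → ∀ w, F (c • w) = c ^ (-(2*s)) * F w)
    (lam : ℝ × ℝ → ℝ × ℝ × ℝ)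
    (hlam : ∀ t, lam t = (1 - t.1 - t.2, t.1, t.2))
    (T : Set (ℝ × ℝ))
    (hT : T = {t : ℝ × ℝ | 0 ≤ t.1 ∧ 0 ≤ t.2 ∧ t.1 + t.2 ≤ 1}) :
    IntegrableOn (fun p : (ℝ × ℝ) × (ℝ × ℝ) => F (lam p.1 - lam p.2)) (T ×ˢ T) volume ∧
    ∫ p in T ×ˢ T, F (lam p.1 - lam p.2) =
      (2 / ((4 - 2*s) * (3 - 2*s) * (2 - 2*s))) *
        ((∫ t in (0:ℝ)..1, F (-t, t - 1, 1)) +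
         (∫ t in (0:ℝ)..1, F (-1, 1 - t, t)) +
         (∫ t in (0:ℝ)..1, F (t, -1, 1 - t))) := by
  set G : ℝ × ℝ → ℝ := fun z => F (-z.1 - z.2, z.1, z.2) with hG
  have hcont : ContinuousOn G {0}ᶜ := by
    refine hFcont.comp (by fun_prop) fun z hz h0 => hz ?_
    exact congrArg Prod.snd h0
  have heven : ∀ z, G (-z) = G z := by
    intro z
    simp only [hG]
    rw [← hFeven]
    simp only [Prod.neg_mk, Prod.fst_neg, Prod.snd_neg, neg_neg]
    congr 2
    ring
  have hhom : ∀ c : ℝ, 0 < c → ∀ z, G (c • z) = c ^ (-(2 * s)) * G z := by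
    intro c hc z
    simp only [hG]
    rw [← hFhom c hc]
    simp only [Prod.smul_fst, Prod.smul_snd, Prod.smul_mk, smul_eq_mul]
    congr 2
    ring
  have hsub : (fun p : (ℝ × ℝ) × (ℝ × ℝ) => F (lam p.1 - lam p.2)) =
      fun p => G (p.1 - p.2) := by
    funext p
    simp only [hG, hlam, Prod.mk_sub_mk, Prod.fst_sub, Prod.snd_sub]
    congr 2
    ring
  have hT' : T = Duffy.triangle := hT
  rw [hsub, hT']
  convert! Duffy.integral_triangle_sub hs.2 hcont heven hhom using 9 <;>
    · simp
      try ring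
end

section
/- Let s ∈ (0,1) and let F : ℝ⁴ → ℝ be continuous on ℝ⁴ \ {0} and positively homogeneous of degree −2s. Define ψ : T × T → ℝ⁴ by ψ(x,y) = (y₁ + y₂ − x₁ − x₂, x₁ − y₁, x₂, −y₂). Then (x,y) ↦ F(ψ(x,y)) is Lebesgue-integrable on T × T and ∫_{T×T} F(ψ(x,y)) d(x,y) = (1 / ((4−2s)(3−2s))) · [ ∫₀¹∫₀¹ F(−a, 1−b, b, a−1) db da + ∫₀¹∫₀¹ a · ( F(−ab, a−1, 1, ab−a) + F(a, ab−1, 1−a, −ab) + F(ab, 1−a, a−ab, −1) + F(ab, a−1, 1−ab, −a) ) db da ]. (This is the Duffy-transformation identity underlying the stiffness-matrix contribution of a pair of triangles sharing an edge, equation (8) with c = 2, after integrating out the radial Duffy variables.) -/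
open MeasureTheory

theorem isAddHaarMeasure_volume_prod_four :
    (volume : Measure ((ℝ × ℝ) × (ℝ × ℝ))).IsAddHaarMeasure :=
  have : (volume : Measure (ℝ × ℝ)).IsAddHaarMeasure :=
    Measure.prod.instIsAddHaarMeasure volume volume
  Measure.prod.instIsAddHaarMeasure volume volume

theorem measurePreserving_measurableEmbedding_of_matrix (M : Matrix (Fin 4) (Fin 4) ℝ)
    (hM : |M.det| = 1) (Φ : (ℝ × ℝ) × (ℝ × ℝ) → (ℝ × ℝ) × (ℝ × ℝ))
    (hΦ : ∀ p, Φ p = let w := M.mulVec ![p.1.1, p.1.2, p.2.1, p.2.2]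
      ((w 0, w 1), (w 2, w 3))) :
    MeasurePreserving Φ ∧ MeasurableEmbedding Φ := by
  have := isAddHaarMeasure_volume_prod_four
  let b := ((Module.Basis.finTwoProd ℝ).prod (Module.Basis.finTwoProd ℝ)).reindex finSumFinEquiv
  let L := Matrix.toLin b b M
  have hdet : |LinearMap.det L| = 1 := by simpa [L] using hM
  have hdet0 : LinearMap.det L ≠ 0 := by
    intro h
    simp [h] at hdet
  have hb : ∀ p, b.repr p = ![p.1.1, p.1.2, p.2.1, p.2.2] := by
    intro p
    funext i
    rw [Module.Basis.repr_reindex_apply]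
    fin_cases i <;> rfl
  have hL : Φ = L := by
    funext p
    rw [hΦ]
    apply b.repr.injective
    ext i
    rw [hb]
    simp only [L, Matrix.toLin_apply, hb, map_sum, map_smul, Module.Basis.repr_self]
    fin_cases i <;> simp [Fin.sum_univ_four, Matrix.mulVec_eq_sum]
  constructor
  · refine ⟨by rw [hL]; exact L.continuous_of_finiteDimensional.measurable, ?_⟩
    rw [hL, Measure.map_linearMap_addHaar_eq_smul_addHaar _ hdet0, abs_inv, hdet]
    simp
  · rw [hL]
    exact (L.equivOfDetNeZero hdet0).toContinuousLinearEquiv.toHomeomorph.measurableEmbedding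

theorem integrable_setIntegral_rpow_triangle {σ : ℝ} (hσ : 0 < σ) :
    let W : ℝ × ℝ → ℝ := fun z => Set.indicator {z : ℝ × ℝ | 0 < z.1 ∧ 0 ≤ z.2 ∧ z.2 + z.1 ≤ 1}
      (fun z => z.1 ^ σ) z
    Integrable W ∧ ∫ z, W z = 1 / ((σ + 2) * (σ + 1)) := by
  intro W
  have hmeas : MeasurableSet {z : ℝ × ℝ | 0 < z.1 ∧ 0 ≤ z.2 ∧ z.2 + z.1 ≤ 1} := by
    measurability
  have hW : Integrable W := by
    rw [integrable_indicator_iff hmeas]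
    have hc : IntegrableOn (fun z : ℝ × ℝ => z.1 ^ σ) (Set.Icc 0 1 ×ˢ Set.Icc 0 1) :=
      (Continuous.continuousOn (by fun_prop (disch := positivity))).integrableOn_compact
        (isCompact_Icc.prod isCompact_Icc)
    refine hc.mono_set ?_
    rintro ⟨x, y⟩ ⟨h1, h2, h3⟩
    simp only [Set.mem_prod, Set.mem_Icc] at *
    refine ⟨⟨?_, ?_⟩, ?_, ?_⟩ <;> linarith
  refine ⟨hW, ?_⟩
  rw [Measure.volume_eq_prod, integral_prod _ hW]
  have hinner : ∀ r, ∫ t, W (r, t) = Set.indicator (Set.Ioc 0 1) (fun r => r ^ σ - r ^ (σ + 1)) r := by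
    intro r
    by_cases hr : r ∈ Set.Ioc (0:ℝ) 1
    · have : (fun t => W (r, t)) = Set.indicator (Set.Icc 0 (1 - r)) (fun _ => r ^ σ) := by
        funext t
        simp only [W, Set.indicator, Set.mem_ofPred_eq, Set.mem_Icc, hr.1, true_and]
        congr 1
        rw [le_sub_iff_add_le]
      rw [this, integral_indicator measurableSet_Icc, setIntegral_const, Set.indicator_of_mem hr]
      have := hr.2
      rw [measureReal_def, Real.volume_Icc, ENNReal.toReal_ofReal (by linarith),
        Real.rpow_add_one hr.1.ne']
      simp only [smul_eq_mul]
      ring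
    · have : (fun t => W (r, t)) = fun _ => 0 := by
        funext t
        apply Set.indicator_of_notMem
        rintro ⟨h1, h2, h3⟩
        exact hr ⟨h1, by simp only at h2 h3; linarith⟩
      rw [this, Set.indicator_of_notMem hr, integral_zero]
  simp_rw [hinner]
  rw [integral_indicator measurableSet_Ioc, ← intervalIntegral.integral_of_le zero_le_one,
    intervalIntegral.integral_sub (intervalIntegral.intervalIntegrable_rpow' (by linarith))
      (intervalIntegral.intervalIntegrable_rpow' (by linarith)),
    integral_rpow (Or.inl (by linarith)), integral_rpow (Or.inl (by linarith))]
  rw [Real.zero_rpow (by positivity), Real.zero_rpow (by positivity)]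
  simp only [Real.one_rpow]
  field_simp
  ring

theorem integrableOn_setIntegral_cone {s : ℝ} (hs : s < 1) {H : ℝ × ℝ × ℝ → ℝ}
    (hHm : Measurable H) (hH : ∀ c : ℝ, 0 < c → ∀ w, H (c • w) = c ^ (-(2 * s)) * H w)
    {D : Set (ℝ × ℝ)} (hDm : MeasurableSet D) (hD : IntegrableOn (fun q => H (1, q)) D)
    {C : Set ((ℝ × ℝ) × (ℝ × ℝ))} (hCm : MeasurableSet C) (hC0 : ∀ z ∈ C, 0 ≤ z.1.1)
    (hC : ∀ r t : ℝ, ∀ q : ℝ × ℝ, 0 < r →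
      (((r, t), r • q) ∈ C ↔ 0 ≤ t ∧ t + r ≤ 1 ∧ q ∈ D)) :
    IntegrableOn (fun z => H (z.1.1, z.2)) C ∧
      ∫ z in C, H (z.1.1, z.2) = 1 / ((4 - 2 * s) * (3 - 2 * s)) * ∫ q in D, H (1, q) := by
  have : (volume : Measure (ℝ × ℝ)).IsAddHaarMeasure :=
    Measure.prod.instIsAddHaarMeasure volume volume
  set f := C.indicator (fun z : (ℝ × ℝ) × (ℝ × ℝ) => H (z.1.1, z.2)) with hf
  set h := D.indicator (fun q : ℝ × ℝ => H (1, q)) with hh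
  obtain ⟨hWi, hWv⟩ := integrable_setIntegral_rpow_triangle (σ := 2 - 2 * s) (by linarith)
  set S := {z : ℝ × ℝ | 0 < z.1 ∧ 0 ≤ z.2 ∧ z.2 + z.1 ≤ 1} with hS
  set W : ℝ × ℝ → ℝ := fun z => S.indicator (fun z => z.1 ^ (2 - 2 * s)) z with hW
  have hhi : Integrable h := (integrable_indicator_iff hDm).2 hD
  have hfm : AEStronglyMeasurable f (volume : Measure ((ℝ × ℝ) × (ℝ × ℝ))) :=
    (Measurable.indicator (by fun_prop) hCm).aestronglyMeasurable
  have hne : ∀ᵐ z : ℝ × ℝ, z.1 ≠ 0 :=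
    Measure.quasiMeasurePreserving_fst.ae (Measure.ae_ne volume (0:ℝ))
  have hsec : ∀ z : ℝ × ℝ, z.1 ≠ 0 →
      ∀ p, f (z, p) = S.indicator (fun z => z.1 ^ (-(2 * s))) z * h (z.1⁻¹ • p) := by
    rintro ⟨r, t⟩ hr p
    rcases lt_or_gt_of_ne hr with hr | hr
    · have h1 : ((r, t), p) ∉ C := fun hc => absurd (hC0 _ hc) (not_le.2 hr)
      have h2 : (r, t) ∉ S := fun hc => absurd hc.1 (not_lt.2 hr.le)
      rw [hf, Set.indicator_of_notMem h1, Set.indicator_of_notMem h2, zero_mul]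
    · simp only at hr
      have hp : p = r • (r⁻¹ • p) := by rw [smul_inv_smul₀ hr.ne']
      have hCp := hC r t (r⁻¹ • p) hr
      have hHp := hH r hr (1, r⁻¹ • p)
      rw [← hp] at hCp
      rw [Prod.smul_mk, ← hp, smul_eq_mul, mul_one] at hHp
      by_cases h2 : (r, t) ∈ S
      · by_cases h3 : r⁻¹ • p ∈ D
        · rw [hf, Set.indicator_of_mem (hCp.2 ⟨h2.2.1, h2.2.2, h3⟩), Set.indicator_of_mem h2, hh,
            Set.indicator_of_mem h3, hHp]
        · rw [hf, Set.indicator_of_notMem (fun hc => h3 (hCp.1 hc).2.2), hh,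
            Set.indicator_of_notMem h3, mul_zero]
      · rw [hf, Set.indicator_of_notMem (fun hc => h2 ⟨hr, (hCp.1 hc).1, (hCp.1 hc).2.1⟩),
          Set.indicator_of_notMem h2, zero_mul]
  have hscale : ∀ z : ℝ × ℝ,
      S.indicator (fun z => z.1 ^ (-(2 * s))) z * |z.1 ^ 2| = W z := by
    intro z
    by_cases hz : z ∈ S
    · rw [hW]
      simp only [Set.indicator_of_mem hz]
      rw [abs_of_nonneg (sq_nonneg _), ← Real.rpow_natCast, ← Real.rpow_add hz.1]
      congr 1
      push_cast
      ring
    · rw [hW]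
      simp only [Set.indicator_of_notMem hz, zero_mul]
  have hWnn : ∀ z, 0 ≤ S.indicator (fun z : ℝ × ℝ => z.1 ^ (-(2 * s))) z := fun z =>
    Set.indicator_nonneg (fun z hz => Real.rpow_nonneg hz.1.le _) z
  have hfin : Module.finrank ℝ (ℝ × ℝ) = 2 := by simp
  have hint : ∀ᵐ z : ℝ × ℝ, ∫ p, f (z, p) = W z * ∫ q, h q := by
    filter_upwards [hne] with z hz
    simp_rw [hsec z hz]
    rw [integral_const_mul, Measure.integral_comp_inv_smul, hfin, smul_eq_mul, ← mul_assoc, hscale]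
  have hintn : ∀ᵐ z : ℝ × ℝ, ∫ p, ‖f (z, p)‖ = W z * ∫ q, ‖h q‖ := by
    filter_upwards [hne] with z hz
    simp_rw [hsec z hz, norm_mul, Real.norm_of_nonneg (hWnn z)]
    rw [integral_const_mul, Measure.integral_comp_inv_smul volume (fun q => ‖h q‖), hfin,
      smul_eq_mul, ← mul_assoc, hscale]
  have hfi : Integrable f := by
    rw [Measure.volume_eq_prod] at hfm ⊢
    rw [integrable_prod_iff hfm]
    constructor
    · filter_upwards [hne] with z hz
      simp_rw [hsec z hz]
      exact (hhi.comp_smul (inv_ne_zero hz)).const_mul _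
    · exact (hWi.mul_const _).congr (hintn.mono fun z hz => hz.symm)
  refine ⟨(integrable_indicator_iff hCm).1 hfi, ?_⟩
  rw [← integral_indicator hCm, ← integral_indicator hDm, ← hf, ← hh, Measure.volume_eq_prod,
    integral_prod _ hfi, integral_congr_ae hint, integral_mul_const, hWv]
  congr 3 <;> ring

theorem setIntegral_triangle {g : ℝ × ℝ → ℝ} {D : Set (ℝ × ℝ)} (hDm : MeasurableSet D)
    (hg : IntegrableOn g D) (hD1 : D ⊆ Set.Icc 0 1 ×ˢ Set.Icc 0 1)
    (hD : ∀ a b : ℝ, 0 < a → a < 1 → b ≠ 0 → b ≠ 1 → ((a, a * b) ∈ D ↔ 0 < b ∧ b < 1)) :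
    ∫ q in D, g q = ∫ a in (0:ℝ)..1, ∫ b in (0:ℝ)..1, a * g (a, a * b) := by
  have hi : Integrable (D.indicator g) := (integrable_indicator_iff hDm).2 hg
  rw [← integral_indicator hDm, Measure.volume_eq_prod, integral_prod _ hi,
    intervalIntegral.integral_of_le zero_le_one, ← integral_indicator measurableSet_Ioc]
  apply integral_congr_ae
  filter_upwards [Measure.ae_ne volume (0:ℝ), Measure.ae_ne volume (1:ℝ)] with a ha0 ha1
  by_cases ha : a ∈ Set.Ioc (0:ℝ) 1
  · rw [Set.indicator_of_mem ha]
    have hpos := ha.1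
    have hscale := Measure.integral_comp_mul_left (fun b => D.indicator g (a, b)) a
    rw [abs_of_pos (inv_pos.2 hpos), smul_eq_mul, eq_inv_mul_iff_mul_eq₀ ha0] at hscale
    rw [← hscale, intervalIntegral.integral_const_mul, intervalIntegral.integral_of_le zero_le_one,
      ← integral_indicator measurableSet_Ioc]
    congr 1
    apply integral_congr_ae
    filter_upwards [Measure.ae_ne volume (0:ℝ), Measure.ae_ne volume (1:ℝ)] with b hb0 hb1
    have := hD a b hpos (lt_of_le_of_ne ha.2 ha1) hb0 hb1
    simp only [Set.indicator, this, Set.mem_Ioc]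
    congr 1
    rw [le_iff_lt_or_eq]
    simp [hb1]
  · rw [Set.indicator_of_notMem ha]
    convert integral_zero ℝ ℝ with b
    apply Set.indicator_of_notMem
    intro hb
    have := (hD1 hb).1
    exact ha ⟨lt_of_le_of_ne this.1 (Ne.symm ha0), this.2⟩

theorem intervalIntegral_intervalIntegral_eq_setIntegral {h : ℝ × ℝ → ℝ}
    (hh : ContinuousOn h (Set.Icc 0 1 ×ˢ Set.Icc 0 1)) :
    ∫ a in (0:ℝ)..1, ∫ b in (0:ℝ)..1, h (a, b) =
      ∫ q in Set.Icc (0:ℝ) 1 ×ˢ Set.Icc (0:ℝ) 1, h q := by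
  have hi := hh.integrableOn_compact (μ := volume) (isCompact_Icc.prod isCompact_Icc)
  rw [Measure.volume_eq_prod] at hi ⊢
  rw [setIntegral_prod _ hi, intervalIntegral.integral_of_le zero_le_one, integral_Icc_eq_integral_Ioc]
  simp_rw [intervalIntegral.integral_of_le zero_le_one (f := fun b => h (_, b)),
    integral_Icc_eq_integral_Ioc]

theorem integrableOn_setIntegral_homogeneous_cone {s : ℝ} (hs : s < 1) {F : ℝ × ℝ × ℝ × ℝ → ℝ}
    (hFcont : ContinuousOn F {w | w ≠ 0})
    (hFhom : ∀ c : ℝ, 0 < c → ∀ w, F (c • w) = c ^ (-(2 * s)) * F w)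
    {Ψ : (ℝ × ℝ) × (ℝ × ℝ) → ℝ × ℝ × ℝ × ℝ} {Φ : (ℝ × ℝ) × (ℝ × ℝ) → (ℝ × ℝ) × (ℝ × ℝ)}
    (hΦ : MeasurePreserving Φ ∧ MeasurableEmbedding Φ) {φ : ℝ × ℝ × ℝ → ℝ × ℝ × ℝ × ℝ}
    (hφc : Continuous φ) (hφs : ∀ (c : ℝ) w, φ (c • w) = c • φ w) (hφ0 : ∀ q, φ (1, q) ≠ 0)
    (hΨ : ∀ z, Ψ (Φ z) = φ (z.1.1, z.2))
    {D : Set (ℝ × ℝ)} (hDm : MeasurableSet D) (hD : D ⊆ Set.Icc 0 1 ×ˢ Set.Icc 0 1)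
    {S : Set ((ℝ × ℝ) × (ℝ × ℝ))} (hSm : MeasurableSet S) (hS0 : ∀ z, Φ z ∈ S → 0 ≤ z.1.1)
    (hS : ∀ r t a b : ℝ, 0 < r →
      (Φ ((r, t), (r * a, r * b)) ∈ S ↔ 0 ≤ t ∧ t + r ≤ 1 ∧ (a, b) ∈ D)) :
    IntegrableOn (fun p => F (Ψ p)) S ∧ IntegrableOn (fun q => F (φ (1, q))) D ∧
      ∫ p in S, F (Ψ p) = 1 / ((4 - 2 * s) * (3 - 2 * s)) * ∫ q in D, F (φ (1, q)) := by
  have hFm : Measurable F := measurable_of_continuousOn_compl_singleton 0 hFcont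
  have hDi : IntegrableOn (fun q => F (φ (1, q))) D := by
    refine IntegrableOn.mono_set (ContinuousOn.integrableOn_compact
      (isCompact_Icc.prod isCompact_Icc) ?_) hD
    exact (hFcont.comp_continuous (by fun_prop) hφ0).continuousOn
  obtain ⟨hi, hv⟩ := integrableOn_setIntegral_cone hs (H := fun w => F (φ w))
    (hFm.comp hφc.measurable) (fun c hc w => by rw [hφs, hFhom c hc]) hDm hDi
    (hΦ.1.measurable hSm) hS0 (fun r t q hr => hS r t q.1 q.2 hr)
  simp_rw [← hΨ] at hi hv
  exact ⟨(hΦ.1.integrableOn_comp_preimage hΦ.2).1 hi, hDi,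
    by rw [← hv, hΦ.1.setIntegral_preimage_emb hΦ.2 (fun p => F (Ψ p)) S]⟩

/-- Pairs of points of the reference triangle. -/
def trianglePairs : Set ((ℝ × ℝ) × (ℝ × ℝ)) :=
  {p | (0 ≤ p.1.1 ∧ 0 ≤ p.1.2 ∧ p.1.1 + p.1.2 ≤ 1) ∧ 0 ≤ p.2.1 ∧ 0 ≤ p.2.2 ∧ p.2.1 + p.2.2 ≤ 1}

/-- The linear map describing the relative position of a pair of points of two triangles
sharing an edge. -/
def commonEdgeMap (p : (ℝ × ℝ) × (ℝ × ℝ)) : ℝ × ℝ × ℝ × ℝ :=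
  (p.2.1 + p.2.2 - p.1.1 - p.1.2, p.1.1 - p.2.1, p.1.2, -p.2.2)

/-- The part of `trianglePairs` on which `x₂ + x₁ - y₁` is the radial coordinate and `y₁ ≤ x₁`. -/
def duffyConeSquare : Set ((ℝ × ℝ) × (ℝ × ℝ)) :=
  trianglePairs ∩ {p | p.2.1 ≤ p.1.1 ∧ p.2.1 + p.2.2 ≤ p.1.1 + p.1.2}

theorem measurableSet_duffyConeSquare : MeasurableSet duffyConeSquare := by
  unfold duffyConeSquare trianglePairs
  measurability

/-- The part of `trianglePairs` on which `x₂` is the radial coordinate. -/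
def duffyConeFirstHeight : Set ((ℝ × ℝ) × (ℝ × ℝ)) :=
  trianglePairs ∩ {p | p.1.1 < p.2.1 ∧ p.2.1 + p.2.2 ≤ p.1.1 + p.1.2}

theorem measurableSet_duffyConeFirstHeight : MeasurableSet duffyConeFirstHeight := by
  unfold duffyConeFirstHeight trianglePairs
  measurability

/-- The part of `trianglePairs` on which `y₂ + y₁ - x₁` is the radial coordinate
and `x₁ + x₂ < y₁`. -/
def duffyConeLowerShear : Set ((ℝ × ℝ) × (ℝ × ℝ)) :=
  trianglePairs ∩ {p | p.1.1 + p.1.2 < p.2.1}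

theorem measurableSet_duffyConeLowerShear : MeasurableSet duffyConeLowerShear := by
  unfold duffyConeLowerShear trianglePairs
  measurability

/-- The part of `trianglePairs` on which `y₂` is the radial coordinate. -/
def duffyConeSecondHeight : Set ((ℝ × ℝ) × (ℝ × ℝ)) :=
  trianglePairs ∩ {p | p.2.1 ≤ p.1.1 ∧ p.1.1 + p.1.2 < p.2.1 + p.2.2}

theorem measurableSet_duffyConeSecondHeight : MeasurableSet duffyConeSecondHeight := by
  unfold duffyConeSecondHeight trianglePairs
  measurability

/-- The part of `trianglePairs` on which `y₂ + y₁ - x₁` is the radial coordinate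
and `x₁ < y₁ ≤ x₁ + x₂`. -/
def duffyConeUpperShear : Set ((ℝ × ℝ) × (ℝ × ℝ)) :=
  trianglePairs ∩ {p | p.1.1 < p.2.1 ∧ p.1.1 + p.1.2 < p.2.1 + p.2.2 ∧ p.2.1 ≤ p.1.1 + p.1.2}

theorem measurableSet_duffyConeUpperShear : MeasurableSet duffyConeUpperShear := by
  unfold duffyConeUpperShear trianglePairs
  measurability

theorem trianglePairs_eq_union : trianglePairs = duffyConeSquare ∪
    (duffyConeFirstHeight ∪ (duffyConeLowerShear ∪ (duffyConeSecondHeight ∪ duffyConeUpperShear))) := by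
  ext p
  simp only [duffyConeSquare, duffyConeFirstHeight, duffyConeLowerShear,
    duffyConeSecondHeight, duffyConeUpperShear, trianglePairs, Set.mem_union, Set.mem_inter_iff, Set.mem_ofPred_eq]
  grind

theorem disjoint_duffyCones :
    Disjoint duffyConeSquare
      (duffyConeFirstHeight ∪ (duffyConeLowerShear ∪ (duffyConeSecondHeight ∪ duffyConeUpperShear))) ∧
    Disjoint duffyConeFirstHeight
      (duffyConeLowerShear ∪ (duffyConeSecondHeight ∪ duffyConeUpperShear)) ∧
    Disjoint duffyConeLowerShear (duffyConeSecondHeight ∪ duffyConeUpperShear) ∧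
    Disjoint duffyConeSecondHeight duffyConeUpperShear := by
  refine ⟨?_, ?_, ?_, ?_⟩ <;> rw [Set.disjoint_left] <;> intro p <;>
    simp only [duffyConeSquare, duffyConeFirstHeight, duffyConeLowerShear,
    duffyConeSecondHeight, duffyConeUpperShear, trianglePairs, Set.mem_union, Set.mem_inter_iff, Set.mem_ofPred_eq] <;>
    grind

theorem mk_mul_mem_triangle_iff {D : Set (ℝ × ℝ)}
    (hD : {q | 0 < q.2 ∧ q.2 < q.1 ∧ q.1 < 1} ⊆ D) (hD' : D ⊆ {q | 0 ≤ q.2 ∧ q.2 ≤ q.1})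
    {a b : ℝ} (ha : 0 < a) (ha1 : a < 1) (hb0 : b ≠ 0) (hb1 : b ≠ 1) :
    (a, a * b) ∈ D ↔ 0 < b ∧ b < 1 := by
  constructor
  · intro hab
    obtain ⟨h1, h2⟩ := hD' hab
    exact ⟨lt_of_le_of_ne ((mul_nonneg_iff_of_pos_left ha).1 h1) hb0.symm,
      lt_of_le_of_ne ((mul_le_iff_le_one_right ha).1 h2) hb1⟩
  · rintro ⟨h1, h2⟩
    exact hD ⟨mul_pos ha h1, (mul_lt_iff_lt_one_right ha).2 h2, ha1⟩

section DuffyCones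

variable {s : ℝ} {F : ℝ × ℝ × ℝ × ℝ → ℝ}

theorem integrableOn_setIntegral_duffyConeSquare (hs : s < 1)
    (hFcont : ContinuousOn F {w | w ≠ 0})
    (hFhom : ∀ c : ℝ, 0 < c → ∀ w, F (c • w) = c ^ (-(2 * s)) * F w) :
    IntegrableOn (fun p => F (commonEdgeMap p)) duffyConeSquare ∧
      ∫ p in duffyConeSquare, F (commonEdgeMap p) = 1 / ((4 - 2 * s) * (3 - 2 * s)) *
        ∫ q in Set.Icc (0:ℝ) 1 ×ˢ Set.Icc (0:ℝ) 1, F (-q.1, 1 - q.2, q.2, q.1 - 1) := by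
  have hDm : MeasurableSet (Set.Icc 0 1 ×ˢ Set.Icc 0 1 : Set (ℝ × ℝ)) := by
    measurability
  obtain ⟨hi, -, hv⟩ := integrableOn_setIntegral_homogeneous_cone hs hFcont hFhom
    (Ψ := commonEdgeMap)
    (Φ := fun z => ((z.1.2 + z.1.1 - z.2.2, z.2.2), (z.1.2, z.1.1 - z.2.1)))
    (φ := fun w => (-w.2.1, w.1 - w.2.2, w.2.2, w.2.1 - w.1))
    (measurePreserving_measurableEmbedding_of_matrix
      !![1, 1, 0, -1; 0, 0, 0, 1; 0, 1, 0, 0; 1, 0, -1, 0]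
      (by simp [Matrix.det_succ_row_zero, Fin.sum_univ_succ, Fin.succAbove]) _
      (fun p => by
        ext <;> simp only [Matrix.mulVec, dotProduct, Fin.sum_univ_four] <;> simp <;> ring))
    (by fun_prop) (fun c w => by simp [mul_sub])
    (fun q h => by simp [Prod.ext_iff] at h; linarith)
    (fun z => by ext <;> simp only [commonEdgeMap] <;> ring)
    hDm subset_rfl measurableSet_duffyConeSquare
    (fun z hz => by
      simp only [duffyConeSquare, trianglePairs, Set.mem_inter_iff, Set.mem_ofPred_eq] at hz
      grind)
    (fun r t a b hr => by
      have e1 : 0 ≤ r * a ↔ 0 ≤ a := mul_nonneg_iff_of_pos_left hr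
      have e2 : 0 ≤ r * b ↔ 0 ≤ b := mul_nonneg_iff_of_pos_left hr
      have e3 : r * a ≤ r ↔ a ≤ 1 := mul_le_iff_le_one_right hr
      have e4 : r * b ≤ r ↔ b ≤ 1 := mul_le_iff_le_one_right hr
      simp only [duffyConeSquare, trianglePairs, Set.mem_inter_iff, Set.mem_ofPred_eq, Set.mem_prod, Set.mem_Icc,
        ← e1, ← e2, ← e3, ← e4]
      grind)
  exact ⟨hi, hv⟩

theorem integrableOn_setIntegral_duffyConeFirstHeight (hs : s < 1)
    (hFcont : ContinuousOn F {w | w ≠ 0})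
    (hFhom : ∀ c : ℝ, 0 < c → ∀ w, F (c • w) = c ^ (-(2 * s)) * F w) :
    IntegrableOn (fun p => F (commonEdgeMap p)) duffyConeFirstHeight ∧
      ∫ p in duffyConeFirstHeight, F (commonEdgeMap p) = 1 / ((4 - 2 * s) * (3 - 2 * s)) *
        ∫ q in Set.Icc (0:ℝ) 1 ×ˢ Set.Icc (0:ℝ) 1,
          q.1 * F (-(q.1 * q.2), q.1 - 1, 1, q.1 * q.2 - q.1) := by
  have hDm : MeasurableSet ({q | 0 ≤ q.2 ∧ q.2 ≤ q.1 ∧ q.1 < 1} : Set (ℝ × ℝ)) := by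
    measurability
  have hD : {q : ℝ × ℝ | 0 ≤ q.2 ∧ q.2 ≤ q.1 ∧ q.1 < 1} ⊆ Set.Icc 0 1 ×ˢ Set.Icc 0 1 := by
    rintro q ⟨h1, h2, h3⟩
    exact ⟨⟨by linarith, by linarith⟩, by linarith, by linarith⟩
  obtain ⟨hi, hd, hv⟩ := integrableOn_setIntegral_homogeneous_cone hs hFcont hFhom
    (Ψ := commonEdgeMap)
    (Φ := fun z => ((z.1.2, z.1.1), (z.1.2 + z.1.1 - z.2.1, z.2.1 - z.2.2)))
    (φ := fun w => (-w.2.2, w.2.1 - w.1, w.1, w.2.2 - w.2.1))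
    (measurePreserving_measurableEmbedding_of_matrix
      !![0, 1, 0, 0; 1, 0, 0, 0; 1, 1, -1, 0; 0, 0, 1, -1]
      (by simp [Matrix.det_succ_row_zero, Fin.sum_univ_succ, Fin.succAbove]) _
      (fun p => by
        ext <;> simp only [Matrix.mulVec, dotProduct, Fin.sum_univ_four] <;> simp <;> ring))
    (by fun_prop) (fun c w => by simp [mul_sub])
    (fun q h => by simp [Prod.ext_iff] at h)
    (fun z => by ext <;> simp only [commonEdgeMap] <;> ring)
    hDm hD measurableSet_duffyConeFirstHeight
    (fun z hz => by
      simp only [duffyConeFirstHeight, trianglePairs, Set.mem_inter_iff, Set.mem_ofPred_eq] at hz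
      grind)
    (fun r t a b hr => by
      have e1 : 0 ≤ r * b ↔ 0 ≤ b := mul_nonneg_iff_of_pos_left hr
      have e2 : r * b ≤ r * a ↔ b ≤ a := mul_le_mul_iff_right₀ hr
      have e3 : r * a < r ↔ a < 1 := mul_lt_iff_lt_one_right hr
      simp only [duffyConeFirstHeight, trianglePairs, Set.mem_inter_iff, Set.mem_ofPred_eq,
        ← e1, ← e2, ← e3]
      grind)
  rw [setIntegral_triangle hDm hd hD fun a b => mk_mul_mem_triangle_iff
      (by rintro q ⟨h1, h2, h3⟩; exact ⟨by linarith, by linarith, by linarith⟩)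
      (by rintro q ⟨h1, h2, h3⟩; exact ⟨by linarith, by linarith⟩),
    intervalIntegral_intervalIntegral_eq_setIntegral
      (h := fun q => q.1 * F (-(q.1 * q.2), q.1 - 1, 1, q.1 * q.2 - q.1))] at hv
  · exact ⟨hi, hv⟩
  · exact (continuous_fst.mul (hFcont.comp_continuous (by fun_prop) fun q h => by
      simp only [Prod.ext_iff, Prod.fst_zero, Prod.snd_zero] at h; linarith)).continuousOn

theorem integrableOn_setIntegral_duffyConeLowerShear (hs : s < 1)
    (hFcont : ContinuousOn F {w | w ≠ 0})
    (hFhom : ∀ c : ℝ, 0 < c → ∀ w, F (c • w) = c ^ (-(2 * s)) * F w) :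
    IntegrableOn (fun p => F (commonEdgeMap p)) duffyConeLowerShear ∧
      ∫ p in duffyConeLowerShear, F (commonEdgeMap p) = 1 / ((4 - 2 * s) * (3 - 2 * s)) *
        ∫ q in Set.Icc (0:ℝ) 1 ×ˢ Set.Icc (0:ℝ) 1,
          q.1 * F (q.1, q.1 * q.2 - 1, 1 - q.1, -(q.1 * q.2)) := by
  have hDm : MeasurableSet ({q | 0 ≤ q.2 ∧ q.2 < q.1 ∧ q.1 ≤ 1} : Set (ℝ × ℝ)) := by
    measurability
  have hD : {q : ℝ × ℝ | 0 ≤ q.2 ∧ q.2 < q.1 ∧ q.1 ≤ 1} ⊆ Set.Icc 0 1 ×ˢ Set.Icc 0 1 := by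
    rintro q ⟨h1, h2, h3⟩
    exact ⟨⟨by linarith, by linarith⟩, by linarith, by linarith⟩
  obtain ⟨hi, hd, hv⟩ := integrableOn_setIntegral_homogeneous_cone hs hFcont hFhom
    (Ψ := commonEdgeMap)
    (Φ := fun z => ((z.1.2, z.1.1 - z.2.1), (z.1.2 + z.1.1 - z.2.2, z.2.2)))
    (φ := fun w => (w.2.1, w.2.2 - w.1, w.1 - w.2.1, -w.2.2))
    (measurePreserving_measurableEmbedding_of_matrix
      !![0, 1, 0, 0; 1, 0, -1, 0; 1, 1, 0, -1; 0, 0, 0, 1]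
      (by simp [Matrix.det_succ_row_zero, Fin.sum_univ_succ, Fin.succAbove]) _
      (fun p => by
        ext <;> simp only [Matrix.mulVec, dotProduct, Fin.sum_univ_four] <;> simp <;> ring))
    (by fun_prop) (fun c w => by simp [mul_sub])
    (fun q h => by simp [Prod.ext_iff] at h; linarith)
    (fun z => by ext <;> simp only [commonEdgeMap] <;> ring)
    hDm hD measurableSet_duffyConeLowerShear
    (fun z hz => by
      simp only [duffyConeLowerShear, trianglePairs, Set.mem_inter_iff, Set.mem_ofPred_eq] at hz
      grind)
    (fun r t a b hr => by
      have e1 : 0 ≤ r * b ↔ 0 ≤ b := mul_nonneg_iff_of_pos_left hr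
      have e2 : r * b < r * a ↔ b < a := mul_lt_mul_iff_right₀ hr
      have e3 : r * a ≤ r ↔ a ≤ 1 := mul_le_iff_le_one_right hr
      simp only [duffyConeLowerShear, trianglePairs, Set.mem_inter_iff, Set.mem_ofPred_eq,
        ← e1, ← e2, ← e3]
      grind)
  rw [setIntegral_triangle hDm hd hD fun a b => mk_mul_mem_triangle_iff
      (by rintro q ⟨h1, h2, h3⟩; exact ⟨by linarith, by linarith, by linarith⟩)
      (by rintro q ⟨h1, h2, h3⟩; exact ⟨by linarith, by linarith⟩),
    intervalIntegral_intervalIntegral_eq_setIntegral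
      (h := fun q => q.1 * F (q.1, q.1 * q.2 - 1, 1 - q.1, -(q.1 * q.2)))] at hv
  · exact ⟨hi, hv⟩
  · exact (continuous_fst.mul (hFcont.comp_continuous (by fun_prop) fun q h => by
      simp only [Prod.ext_iff, Prod.fst_zero, Prod.snd_zero] at h; linarith)).continuousOn

theorem integrableOn_setIntegral_duffyConeSecondHeight (hs : s < 1)
    (hFcont : ContinuousOn F {w | w ≠ 0})
    (hFhom : ∀ c : ℝ, 0 < c → ∀ w, F (c • w) = c ^ (-(2 * s)) * F w) :
    IntegrableOn (fun p => F (commonEdgeMap p)) duffyConeSecondHeight ∧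
      ∫ p in duffyConeSecondHeight, F (commonEdgeMap p) = 1 / ((4 - 2 * s) * (3 - 2 * s)) *
        ∫ q in Set.Icc (0:ℝ) 1 ×ˢ Set.Icc (0:ℝ) 1,
          q.1 * F (q.1 * q.2, 1 - q.1, q.1 - q.1 * q.2, -1) := by
  have hDm : MeasurableSet ({q | 0 < q.2 ∧ q.2 ≤ q.1 ∧ q.1 ≤ 1} : Set (ℝ × ℝ)) := by
    measurability
  have hD : {q : ℝ × ℝ | 0 < q.2 ∧ q.2 ≤ q.1 ∧ q.1 ≤ 1} ⊆ Set.Icc 0 1 ×ˢ Set.Icc 0 1 := by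
    rintro q ⟨h1, h2, h3⟩
    exact ⟨⟨by linarith, by linarith⟩, by linarith, by linarith⟩
  obtain ⟨hi, hd, hv⟩ := integrableOn_setIntegral_homogeneous_cone hs hFcont hFhom
    (Ψ := commonEdgeMap)
    (Φ := fun z => ((z.1.2 + z.1.1 - z.2.1, z.2.1 - z.2.2), (z.1.2, z.1.1)))
    (φ := fun w => (w.2.2, w.1 - w.2.1, w.2.1 - w.2.2, -w.1))
    (measurePreserving_measurableEmbedding_of_matrix
      !![1, 1, -1, 0; 0, 0, 1, -1; 0, 1, 0, 0; 1, 0, 0, 0]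
      (by simp [Matrix.det_succ_row_zero, Fin.sum_univ_succ, Fin.succAbove]) _
      (fun p => by
        ext <;> simp only [Matrix.mulVec, dotProduct, Fin.sum_univ_four] <;> simp <;> ring))
    (by fun_prop) (fun c w => by simp [mul_sub])
    (fun q h => by simp [Prod.ext_iff] at h)
    (fun z => by ext <;> simp only [commonEdgeMap] <;> ring)
    hDm hD measurableSet_duffyConeSecondHeight
    (fun z hz => by
      simp only [duffyConeSecondHeight, trianglePairs, Set.mem_inter_iff, Set.mem_ofPred_eq] at hz
      grind)
    (fun r t a b hr => by
      have e1 : 0 < r * b ↔ 0 < b := mul_pos_iff_of_pos_left hr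
      have e2 : r * b ≤ r * a ↔ b ≤ a := mul_le_mul_iff_right₀ hr
      have e3 : r * a ≤ r ↔ a ≤ 1 := mul_le_iff_le_one_right hr
      simp only [duffyConeSecondHeight, trianglePairs, Set.mem_inter_iff, Set.mem_ofPred_eq,
        ← e1, ← e2, ← e3]
      grind)
  rw [setIntegral_triangle hDm hd hD fun a b => mk_mul_mem_triangle_iff
      (by rintro q ⟨h1, h2, h3⟩; exact ⟨by linarith, by linarith, by linarith⟩)
      (by rintro q ⟨h1, h2, h3⟩; exact ⟨by linarith, by linarith⟩),
    intervalIntegral_intervalIntegral_eq_setIntegral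
      (h := fun q => q.1 * F (q.1 * q.2, 1 - q.1, q.1 - q.1 * q.2, -1))] at hv
  · exact ⟨hi, hv⟩
  · exact (continuous_fst.mul (hFcont.comp_continuous (by fun_prop) fun q h => by
      simp only [Prod.ext_iff, Prod.fst_zero, Prod.snd_zero] at h; linarith)).continuousOn

theorem integrableOn_setIntegral_duffyConeUpperShear (hs : s < 1)
    (hFcont : ContinuousOn F {w | w ≠ 0})
    (hFhom : ∀ c : ℝ, 0 < c → ∀ w, F (c • w) = c ^ (-(2 * s)) * F w) :
    IntegrableOn (fun p => F (commonEdgeMap p)) duffyConeUpperShear ∧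
      ∫ p in duffyConeUpperShear, F (commonEdgeMap p) = 1 / ((4 - 2 * s) * (3 - 2 * s)) *
        ∫ q in Set.Icc (0:ℝ) 1 ×ˢ Set.Icc (0:ℝ) 1,
          q.1 * F (q.1 * q.2, q.1 - 1, 1 - q.1 * q.2, -q.1) := by
  have hDm : MeasurableSet ({q | 0 < q.2 ∧ q.2 ≤ q.1 ∧ q.1 < 1} : Set (ℝ × ℝ)) := by
    measurability
  have hD : {q : ℝ × ℝ | 0 < q.2 ∧ q.2 ≤ q.1 ∧ q.1 < 1} ⊆ Set.Icc 0 1 ×ˢ Set.Icc 0 1 := by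
    rintro q ⟨h1, h2, h3⟩
    exact ⟨⟨by linarith, by linarith⟩, by linarith, by linarith⟩
  obtain ⟨hi, hd, hv⟩ := integrableOn_setIntegral_homogeneous_cone hs hFcont hFhom
    (Ψ := commonEdgeMap)
    (Φ := fun z => ((z.1.2, z.1.1 - z.2.2), (z.1.2 + z.1.1 - z.2.1, z.2.1)))
    (φ := fun w => (w.2.2, w.2.1 - w.1, w.1 - w.2.2, -w.2.1))
    (measurePreserving_measurableEmbedding_of_matrix
      !![0, 1, 0, 0; 1, 0, 0, -1; 1, 1, -1, 0; 0, 0, 1, 0]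
      (by simp [Matrix.det_succ_row_zero, Fin.sum_univ_succ, Fin.succAbove]) _
      (fun p => by
        ext <;> simp only [Matrix.mulVec, dotProduct, Fin.sum_univ_four] <;> simp <;> ring))
    (by fun_prop) (fun c w => by simp [mul_sub])
    (fun q h => by simp [Prod.ext_iff] at h; linarith)
    (fun z => by ext <;> simp only [commonEdgeMap] <;> ring)
    hDm hD measurableSet_duffyConeUpperShear
    (fun z hz => by
      simp only [duffyConeUpperShear, trianglePairs, Set.mem_inter_iff, Set.mem_ofPred_eq] at hz
      grind)
    (fun r t a b hr => by
      have e1 : 0 < r * b ↔ 0 < b := mul_pos_iff_of_pos_left hr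
      have e2 : r * b ≤ r * a ↔ b ≤ a := mul_le_mul_iff_right₀ hr
      have e3 : r * a < r ↔ a < 1 := mul_lt_iff_lt_one_right hr
      simp only [duffyConeUpperShear, trianglePairs, Set.mem_inter_iff, Set.mem_ofPred_eq,
        ← e1, ← e2, ← e3]
      grind)
  rw [setIntegral_triangle hDm hd hD fun a b => mk_mul_mem_triangle_iff
      (by rintro q ⟨h1, h2, h3⟩; exact ⟨by linarith, by linarith, by linarith⟩)
      (by rintro q ⟨h1, h2, h3⟩; exact ⟨by linarith, by linarith⟩),
    intervalIntegral_intervalIntegral_eq_setIntegral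
      (h := fun q => q.1 * F (q.1 * q.2, q.1 - 1, 1 - q.1 * q.2, -q.1))] at hv
  · exact ⟨hi, hv⟩
  · exact (continuous_fst.mul (hFcont.comp_continuous (by fun_prop) fun q h => by
      simp only [Prod.ext_iff, Prod.fst_zero, Prod.snd_zero] at h; linarith)).continuousOn

end DuffyCones

/-- Duffy-transformation identity for a pair of triangles sharing an edge
(equation (8) with c = 2, radial Duffy variables integrated out). -/
theorem duffy_common_edge (s : ℝ) (hs : s ∈ Set.Ioo (0:ℝ) 1)
    (F : ℝ × ℝ × ℝ × ℝ → ℝ)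
    (hFcont : ContinuousOn F {w | w ≠ 0})
    (hFhom : ∀ c : ℝ, 0 < c → ∀ w, F (c • w) = c ^ (-(2*s)) * F w)
    (ψ : (ℝ × ℝ) → (ℝ × ℝ) → ℝ × ℝ × ℝ × ℝ)
    (hψ : ∀ x y, ψ x y = (y.1 + y.2 - x.1 - x.2, x.1 - y.1, x.2, -y.2))
    (T : Set (ℝ × ℝ))
    (hT : T = {t : ℝ × ℝ | 0 ≤ t.1 ∧ 0 ≤ t.2 ∧ t.1 + t.2 ≤ 1}) :
    IntegrableOn (fun p : (ℝ × ℝ) × (ℝ × ℝ) => F (ψ p.1 p.2)) (T ×ˢ T) volume ∧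
    ∫ p in T ×ˢ T, F (ψ p.1 p.2) =
      (1 / ((4 - 2*s) * (3 - 2*s))) *
        ((∫ a in (0:ℝ)..1, ∫ b in (0:ℝ)..1, F (-a, 1 - b, b, a - 1)) +
         (∫ a in (0:ℝ)..1, ∫ b in (0:ℝ)..1, a *
            (F (-(a*b), a - 1, 1, a*b - a) +
             F (a, a*b - 1, 1 - a, -(a*b)) +
             F (a*b, 1 - a, a - a*b, -1) +
             F (a*b, a - 1, 1 - a*b, -a)))) := by
  have hTT : T ×ˢ T = trianglePairs := by
    rw [hT]
    rfl
  have hψ' : ∀ p : (ℝ × ℝ) × (ℝ × ℝ), ψ p.1 p.2 = commonEdgeMap p := fun p => hψ _ _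
  simp_rw [hψ', hTT]
  obtain ⟨hi₁, hv₁⟩ := integrableOn_setIntegral_duffyConeSquare hs.2 hFcont hFhom
  obtain ⟨hi₂, hv₂⟩ := integrableOn_setIntegral_duffyConeFirstHeight hs.2 hFcont hFhom
  obtain ⟨hi₃, hv₃⟩ := integrableOn_setIntegral_duffyConeLowerShear hs.2 hFcont hFhom
  obtain ⟨hi₄, hv₄⟩ := integrableOn_setIntegral_duffyConeSecondHeight hs.2 hFcont hFhom
  obtain ⟨hi₅, hv₅⟩ := integrableOn_setIntegral_duffyConeUpperShear hs.2 hFcont hFhom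
  have hm₅ := measurableSet_duffyConeUpperShear
  have hm₄ := measurableSet_duffyConeSecondHeight.union hm₅
  have hm₃ := measurableSet_duffyConeLowerShear.union hm₄
  have hm₂ := measurableSet_duffyConeFirstHeight.union hm₃
  have hi₄₅ := hi₄.union hi₅
  have hi₃₅ := hi₃.union hi₄₅
  have hi₂₅ := hi₂.union hi₃₅
  have hunion := trianglePairs_eq_union
  obtain ⟨hdj₁, hdj₂, hdj₃, hdj₄⟩ := disjoint_duffyCones
  refine ⟨by rw [hunion]; exact hi₁.union hi₂₅, ?_⟩
  have hF : ∀ {φ : ℝ × ℝ → ℝ × ℝ × ℝ × ℝ}, Continuous φ → (∀ q, φ q ≠ 0) →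
      Continuous fun q => F (φ q) := fun hφ h0 => hFcont.comp_continuous hφ h0
  have hc₁ : Continuous fun q : ℝ × ℝ => F (-q.1, 1 - q.2, q.2, q.1 - 1) :=
    hF (by fun_prop) fun q h => by
      simp only [Prod.ext_iff, Prod.fst_zero, Prod.snd_zero] at h; linarith
  have hc₂ : Continuous fun q : ℝ × ℝ => F (-(q.1 * q.2), q.1 - 1, 1, q.1 * q.2 - q.1) :=
    hF (by fun_prop) fun q h => by
      simp only [Prod.ext_iff, Prod.fst_zero, Prod.snd_zero] at h; linarith
  have hc₃ : Continuous fun q : ℝ × ℝ => F (q.1, q.1 * q.2 - 1, 1 - q.1, -(q.1 * q.2)) :=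
    hF (by fun_prop) fun q h => by
      simp only [Prod.ext_iff, Prod.fst_zero, Prod.snd_zero] at h; linarith
  have hc₄ : Continuous fun q : ℝ × ℝ => F (q.1 * q.2, 1 - q.1, q.1 - q.1 * q.2, -1) :=
    hF (by fun_prop) fun q h => by
      simp only [Prod.ext_iff, Prod.fst_zero, Prod.snd_zero] at h; linarith
  have hc₅ : Continuous fun q : ℝ × ℝ => F (q.1 * q.2, q.1 - 1, 1 - q.1 * q.2, -q.1) :=
    hF (by fun_prop) fun q h => by
      simp only [Prod.ext_iff, Prod.fst_zero, Prod.snd_zero] at h; linarith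
  have hbox : ∀ {g : ℝ × ℝ → ℝ}, Continuous g → IntegrableOn g (Set.Icc 0 1 ×ˢ Set.Icc 0 1) :=
    fun hg => hg.continuousOn.integrableOn_compact (isCompact_Icc.prod isCompact_Icc)
  rw [intervalIntegral_intervalIntegral_eq_setIntegral
      (h := fun q => F (-q.1, 1 - q.2, q.2, q.1 - 1)) hc₁.continuousOn,
    intervalIntegral_intervalIntegral_eq_setIntegral
      (h := fun q => q.1 * (F (-(q.1 * q.2), q.1 - 1, 1, q.1 * q.2 - q.1) +
        F (q.1, q.1 * q.2 - 1, 1 - q.1, -(q.1 * q.2)) +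
        F (q.1 * q.2, 1 - q.1, q.1 - q.1 * q.2, -1) +
        F (q.1 * q.2, q.1 - 1, 1 - q.1 * q.2, -q.1)))
      (continuous_fst.mul (((hc₂.add hc₃).add hc₄).add hc₅)).continuousOn]
  simp_rw [mul_add]
  have hg₂ := continuous_fst.mul hc₂
  have hg₃ := continuous_fst.mul hc₃
  have hg₄ := continuous_fst.mul hc₄
  have hg₅ := continuous_fst.mul hc₅
  rw [integral_add (hbox (by exact (hg₂.add hg₃).add hg₄)) (hbox (by exact hg₅)),
    integral_add (hbox (by exact hg₂.add hg₃)) (hbox (by exact hg₄)),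
    integral_add (hbox (by exact hg₂)) (hbox (by exact hg₃)),
    hunion, setIntegral_union hdj₁ hm₂ hi₁ hi₂₅, setIntegral_union hdj₂ hm₃ hi₂ hi₃₅,
    setIntegral_union hdj₃ hm₄ hi₃ hi₄₅, setIntegral_union hdj₄ hm₅ hi₄ hi₅,
    hv₁, hv₂, hv₃, hv₄, hv₅]
  ring
end

section
/- Let s ∈ (0,1) and let F : ℝ⁵ → ℝ be continuous on ℝ⁵ \ {0} and positively homogeneous of degree −2s. Define ψ : T × T → ℝ⁵ by ψ(x,y) = (y₁ + y₂ − x₁ − x₂, x₁, x₂, −y₁, −y₂). Then (x,y) ↦ F(ψ(x,y)) is Lebesgue-integrable on T × T and ∫_{T×T} F(ψ(x,y)) d(x,y) = (1/(4−2s)) · ∫₀¹∫₀¹∫₀¹ b · [ F(b−1, 1−a, a, bc−b, −bc) + F(1−b, b−bc, bc, a−1, −a) ] da db dc. (This is the Duffy-transformation identity underlying the stiffness-matrix contribution of a pair of triangles sharing exactly one vertex, equation (8) with c = 1, after integrating out the radial Duffy variable.) -/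
open MeasureTheory

open Set

/-- The measure `r ^ k dr` on the unit interval. -/
noncomputable def unitWeight (k : ℕ) : Measure ℝ :=
  (volume.restrict (Ioc (0 : ℝ) 1)).withDensity fun r => ENNReal.ofReal (r ^ k)

instance unitWeight.instIsFiniteMeasure (k : ℕ) : IsFiniteMeasure (unitWeight k) := by
  refine isFiniteMeasure_withDensity_ofReal ?_
  exact (((continuous_id.pow k).integrableOn_Icc).mono_set Ioc_subset_Icc_self).2

theorem ae_unitWeight_mem (k : ℕ) : ∀ᵐ r ∂unitWeight k, r ∈ Ioc (0 : ℝ) 1 :=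
  (withDensity_absolutelyContinuous _ _).ae_le (ae_restrict_mem measurableSet_Ioc)

theorem integral_unitWeight (k : ℕ) (f : ℝ → ℝ) :
    ∫ r, f r ∂unitWeight k = ∫ r in (0 : ℝ)..1, r ^ k * f r := by
  rw [unitWeight, integral_withDensity_eq_integral_toReal_smul (by fun_prop) (by simp),
    intervalIntegral.integral_of_le zero_le_one]
  refine setIntegral_congr_fun measurableSet_Ioc fun r hr => ?_
  simp only [smul_eq_mul]
  rw [ENNReal.toReal_ofReal (pow_nonneg hr.1.le k)]

theorem integrable_unitWeight_iff (k : ℕ) (f : ℝ → ℝ) :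
    Integrable f (unitWeight k) ↔ IntegrableOn (fun r => r ^ k * f r) (Ioc 0 1) := by
  rw [unitWeight, integrable_withDensity_iff_integrable_smul' (by fun_prop) (by simp)]
  refine integrableOn_congr_fun (fun r hr => ?_) measurableSet_Ioc
  simp only [smul_eq_mul]
  rw [ENNReal.toReal_ofReal (pow_nonneg hr.1.le k)]

theorem lintegral_unitWeight_prod (j k : ℕ) {g : ℝ × ℝ → ENNReal} (hg : Measurable g) :
    ∫⁻ p, g p ∂(unitWeight j).prod (unitWeight k) =
      ∫⁻ p in Ioc (0 : ℝ) 1 ×ˢ Ioc (0 : ℝ) 1,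
        ENNReal.ofReal (p.1 ^ j) * ENNReal.ofReal (p.2 ^ k) * g p := by
  rw [unitWeight, unitWeight, prod_withDensity (by fun_prop) (by fun_prop),
    Measure.prod_restrict, lintegral_withDensity_eq_lintegral_mul _ (by fun_prop) hg]
  rfl

/-- The map `(r, b) ↦ (r (1 - t b), r b)`: for `t = 1` the Duffy parametrization of the reference
triangle, for `t = 0` that of the triangle below the diagonal of the unit square. -/
def duffyMap (t : ℝ) (p : ℝ × ℝ) : ℝ × ℝ := (p.1 * (1 - t * p.2), p.1 * p.2)

@[fun_prop]
theorem measurable_duffyMap (t : ℝ) : Measurable (duffyMap t) := by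
  unfold duffyMap
  fun_prop

theorem hasFDerivAt_duffyMap (t : ℝ) (p : ℝ × ℝ) :
    HasFDerivAt (duffyMap t) (Matrix.toLin (.finTwoProd ℝ) (.finTwoProd ℝ)
      !![1 - t * p.2, -(t * p.1); p.2, p.1]).toContinuousLinearMap p := by
  rw [Matrix.toLin_finTwoProd_toContinuousLinearMap]
  have hfst : HasFDerivAt (fun q : ℝ × ℝ => q.1) (ContinuousLinearMap.fst ℝ ℝ ℝ) p :=
    hasFDerivAt_fst
  have hsnd : HasFDerivAt (fun q : ℝ × ℝ => q.2) (ContinuousLinearMap.snd ℝ ℝ ℝ) p :=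
    hasFDerivAt_snd
  convert! (hfst.mul ((hsnd.const_mul t).const_sub 1)).prodMk (hfst.mul hsnd) using 2 <;>
  simp [smul_smul, add_comm, mul_comm, neg_smul _ (ContinuousLinearMap.snd ℝ ℝ ℝ)]

theorem injOn_duffyMap (t : ℝ) (B : Set ℝ) : InjOn (duffyMap t) (Ioc 0 1 ×ˢ B) := by
  rintro ⟨r, b⟩ ⟨hr, -⟩ ⟨r', b'⟩ - h
  simp only [duffyMap, Prod.mk.injEq] at h ⊢
  have hrr : r = r' := by linear_combination h.1 + t * h.2
  subst hrr
  exact ⟨rfl, mul_left_cancel₀ hr.1.ne' h.2⟩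

theorem lintegral_image_duffyMap (t : ℝ) {B : Set ℝ} (hB : MeasurableSet B)
    (g : ℝ × ℝ → ENNReal) :
    ∫⁻ p in duffyMap t '' (Ioc 0 1 ×ˢ B), g p =
      ∫⁻ p in Ioc 0 1 ×ˢ B, ENNReal.ofReal p.1 * g (duffyMap t p) := by
  rw [lintegral_image_eq_lintegral_abs_det_fderiv_mul volume (measurableSet_Ioc.prod hB)
    (fun p _ => (hasFDerivAt_duffyMap t p).hasFDerivWithinAt) (injOn_duffyMap t B)]
  refine setLIntegral_congr_fun (measurableSet_Ioc.prod hB) fun p hp => ?_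
  simp only [LinearMap.det_toContinuousLinearMap, LinearMap.det_toLin, Matrix.det_fin_two_of]
  rw [show (1 - t * p.2) * p.1 - -(t * p.1) * p.2 = p.1 by ring, abs_of_pos hp.1.1]

/-- The reference triangle, parametrized by the Duffy map. -/
theorem measurePreserving_duffyMap_triangle :
    MeasurePreserving (duffyMap 1) ((unitWeight 1).prod (unitWeight 0))
      (volume.restrict {t : ℝ × ℝ | 0 ≤ t.1 ∧ 0 ≤ t.2 ∧ t.1 + t.2 ≤ 1}) := by
  refine ⟨by fun_prop, ?_⟩
  have himage : duffyMap 1 '' (Ioc 0 1 ×ˢ Ioc 0 1) =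
      {t : ℝ × ℝ | 0 ≤ t.1 ∧ 0 < t.2 ∧ t.1 + t.2 ≤ 1} := by
    ext ⟨x, y⟩
    simp only [duffyMap, mem_image, mem_prod, mem_Ioc, Prod.exists, Prod.mk.injEq, mem_ofPred_eq]
    constructor
    · rintro ⟨r, b, ⟨⟨hr, hr1⟩, hb, hb1⟩, rfl, rfl⟩
      refine ⟨mul_nonneg hr.le (by linarith), by positivity, by linarith⟩
    · rintro ⟨hx, hy, hxy⟩
      have hpos : 0 < x + y := by linarith
      refine ⟨x + y, y / (x + y), ⟨⟨hpos, hxy⟩, by positivity, ?_⟩, ?_, ?_⟩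
      · rw [div_le_one hpos]; linarith
      · field_simp; ring
      · field_simp
  have hae : {t : ℝ × ℝ | 0 ≤ t.1 ∧ 0 ≤ t.2 ∧ t.1 + t.2 ≤ 1} =ᵐ[volume]
      duffyMap 1 '' (Ioc 0 1 ×ˢ Ioc 0 1) := by
    have hne : ∀ᵐ p : ℝ × ℝ, p.2 ≠ 0 :=
      (Measure.quasiMeasurePreserving_snd (μ := (volume : Measure ℝ))
        (ν := (volume : Measure ℝ))).ae (Measure.ae_ne volume 0)
    rw [himage]
    filter_upwards [hne] with p hp
    refine propext (and_congr_right fun _ => and_congr_left fun _ => ?_)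
    exact ⟨fun h => lt_of_le_of_ne h hp.symm, le_of_lt⟩
  rw [Measure.restrict_congr_set hae]
  refine Measure.ext_of_lintegral _ fun g hg => ?_
  rw [lintegral_map hg (by fun_prop), lintegral_image_duffyMap 1 measurableSet_Ioc,
    lintegral_unitWeight_prod _ _ (by fun_prop)]
  simp

/-- Splitting the weighted unit square along its diagonal into two Duffy triangles. -/
theorem unitWeight_one_prod_self :
    (unitWeight 1).prod (unitWeight 1) =
      ((unitWeight 3).prod (unitWeight 1)).map (duffyMap 0) +
      ((unitWeight 3).prod (unitWeight 1)).map (Prod.swap ∘ duffyMap 0) := by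
  have hbelow {B : Set ℝ} (hB : MeasurableSet B) (hB1 : B =ᵐ[volume] Ioc (0 : ℝ) 1)
      (hB0 : B ⊆ Ioc 0 1)
      {g : ℝ × ℝ → ENNReal} (hg : Measurable g) :
      ∫⁻ p in duffyMap 0 '' (Ioc 0 1 ×ˢ B),
        ENNReal.ofReal (p.1 ^ 1) * ENNReal.ofReal (p.2 ^ 1) * g p =
      ∫⁻ p, g (duffyMap 0 p) ∂(unitWeight 3).prod (unitWeight 1) := by
    rw [lintegral_image_duffyMap 0 hB, lintegral_unitWeight_prod _ _ (by fun_prop),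
      Measure.volume_eq_prod,
      ← setLIntegral_congr (Measure.set_prod_ae_eq (ae_eq_refl (Ioc (0 : ℝ) 1)) hB1)]
    refine setLIntegral_congr_fun (measurableSet_Ioc.prod hB) fun p hp => ?_
    have h1 : 0 < p.1 := hp.1.1
    have h2 : 0 < p.2 := (hB0 hp.2).1
    simp only [← mul_assoc]
    congr 1
    simp only [duffyMap]
    rw [← ENNReal.ofReal_mul (by positivity), ← ENNReal.ofReal_mul (by simp; positivity),
      ← ENNReal.ofReal_mul (by positivity)]
    congr 1
    ring
  have himage (B : Set ℝ) : duffyMap 0 '' (Ioc 0 1 ×ˢ B) =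
      {p : ℝ × ℝ | p.1 ∈ Ioc (0 : ℝ) 1 ∧ p.2 / p.1 ∈ B} := by
    ext ⟨x, y⟩
    simp only [duffyMap, mem_image, mem_prod, mem_ofPred_eq, Prod.exists, Prod.mk.injEq]
    constructor
    · rintro ⟨r, b, ⟨hr, hb⟩, rfl, rfl⟩
      have := hr.1.ne'
      simpa [this] using ⟨hr, hb⟩
    · rintro ⟨hx, hy⟩
      have := hx.1.ne'
      exact ⟨x, y / x, ⟨hx, hy⟩, by ring, by field_simp⟩
  have himeas {B : Set ℝ} (hB : MeasurableSet B) :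
      MeasurableSet (duffyMap 0 '' (Ioc 0 1 ×ˢ B)) := by
    rw [himage]
    exact (measurable_fst measurableSet_Ioc).inter ((measurable_snd.div measurable_fst) hB)
  have hcover : Ioc (0 : ℝ) 1 ×ˢ Ioc (0 : ℝ) 1 = duffyMap 0 '' (Ioc 0 1 ×ˢ Ioc 0 1) ∪
      Prod.swap ⁻¹' (duffyMap 0 '' (Ioc 0 1 ×ˢ Ioo 0 1)) := by
    rw [himage, himage]
    ext ⟨x, y⟩
    simp only [mem_prod, mem_Ioc, mem_union, mem_ofPred_eq, mem_preimage, Prod.swap_prod_mk, mem_Ioo]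
    constructor
    · rintro ⟨⟨hx, hx1⟩, hy, hy1⟩
      rcases le_or_gt y x with h | h
      · exact Or.inl ⟨⟨hx, hx1⟩, by positivity, (div_le_one hx).2 h⟩
      · exact Or.inr ⟨⟨hy, hy1⟩, by positivity, (div_lt_one hy).2 h⟩
    · rintro (⟨⟨hx, hx1⟩, h0, h1⟩ | ⟨⟨hx, hx1⟩, h0, h1⟩)
      · have := (div_le_one hx).1 h1
        exact ⟨⟨hx, hx1⟩, (div_pos_iff_of_pos_right hx).1 h0, by linarith⟩
      · have := (div_lt_one hx).1 h1
        exact ⟨⟨(div_pos_iff_of_pos_right hx).1 h0, by linarith⟩, hx, hx1⟩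
  have hdisj : Disjoint (duffyMap 0 '' (Ioc 0 1 ×ˢ Ioc 0 1))
      (Prod.swap ⁻¹' (duffyMap 0 '' (Ioc 0 1 ×ˢ Ioo 0 1))) := by
    rw [himage, himage, Set.disjoint_left]
    rintro ⟨x, y⟩ ⟨hx, -, h⟩ ⟨hy, -, h'⟩
    have h1 := (div_le_one hx.1).1 h
    have h2 := (div_lt_one hy.1).1 h'
    simp only [Prod.swap_prod_mk] at h1 h2
    linarith
  refine Measure.ext_of_lintegral _ fun g hg => ?_
  rw [lintegral_add_measure, lintegral_map hg (by fun_prop), lintegral_map hg (by fun_prop),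
    lintegral_unitWeight_prod _ _ hg, hcover,
    lintegral_union (measurable_swap (himeas measurableSet_Ioo)) hdisj,
    hbelow measurableSet_Ioc (ae_eq_refl _) subset_rfl hg]
  congr 1
  have hswap := (Measure.measurePreserving_swap (μ := (volume : Measure ℝ))
    (ν := (volume : Measure ℝ))).setLIntegral_comp_preimage
    (himeas (measurableSet_Ioo (a := (0 : ℝ)) (b := 1)))
    (f := fun p => ENNReal.ofReal (p.1 ^ 1) * ENNReal.ofReal (p.2 ^ 1) * g p.swap)
    (by fun_prop)
  refine Eq.trans ?_ (hswap.trans (hbelow measurableSet_Ioo Ioo_ae_eq_Ioc Ioo_subset_Ioc_self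
    (g := g ∘ Prod.swap) (by fun_prop)))
  refine lintegral_congr fun p => ?_
  simp [mul_comm (ENNReal.ofReal p.1)]

theorem measurePreserving_prodProdProdComm {α β γ δ : Type*} [MeasurableSpace α]
    [MeasurableSpace β] [MeasurableSpace γ] [MeasurableSpace δ] (μ : Measure α) (ν : Measure β)
    (ρ : Measure γ) (τ : Measure δ) [SFinite μ] [SFinite ν] [SFinite ρ] [SFinite τ] :
    MeasurePreserving (Equiv.prodProdProdComm α β γ δ) ((μ.prod ν).prod (ρ.prod τ))
      ((μ.prod ρ).prod (ν.prod τ)) := by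
  have hinner : MeasurePreserving (fun p : β × γ × δ => (p.2.1, p.1, p.2.2))
      (ν.prod (ρ.prod τ)) (ρ.prod (ν.prod τ)) :=
    (measurePreserving_prodAssoc ρ ν τ).comp
      ((Measure.measurePreserving_swap.prod (MeasurePreserving.id τ)).comp
        (measurePreserving_prodAssoc ν ρ τ).symm)
  exact (measurePreserving_prodAssoc μ ρ (ν.prod τ)).symm.comp
    (((MeasurePreserving.id μ).prod hinner).comp (measurePreserving_prodAssoc μ ν (ρ.prod τ)))

/-- The Duffy parametrization, in the variables `(r, c, b, a)`, of the half of `T × T` where the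
first point is farther from the common vertex than the second. -/
def duffyPair (q : ℝ × ℝ × ℝ × ℝ) : (ℝ × ℝ) × (ℝ × ℝ) :=
  (duffyMap 1 (q.1, q.2.2.2), duffyMap 1 (q.1 * q.2.2.1, q.2.1))

@[fun_prop]
theorem measurable_duffyPair : Measurable duffyPair := by
  unfold duffyPair
  fun_prop

theorem restrict_triangle_prod_self :
    (volume.restrict ({t : ℝ × ℝ | 0 ≤ t.1 ∧ 0 ≤ t.2 ∧ t.1 + t.2 ≤ 1} ×ˢ
      {t : ℝ × ℝ | 0 ≤ t.1 ∧ 0 ≤ t.2 ∧ t.1 + t.2 ≤ 1}) : Measure ((ℝ × ℝ) × (ℝ × ℝ))) =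
      ((unitWeight 3).prod
        ((unitWeight 0).prod ((unitWeight 1).prod (unitWeight 0)))).map duffyPair +
      ((unitWeight 3).prod
        ((unitWeight 0).prod ((unitWeight 1).prod (unitWeight 0)))).map
          (Prod.swap ∘ duffyPair) := by
  have hreorder : MeasurePreserving
      (fun q : ℝ × ℝ × ℝ × ℝ => ((q.1, q.2.2.1), (q.2.2.2, q.2.1)))
      ((unitWeight 3).prod ((unitWeight 0).prod ((unitWeight 1).prod (unitWeight 0))))
      (((unitWeight 3).prod (unitWeight 1)).prod ((unitWeight 0).prod (unitWeight 0))) :=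
    (measurePreserving_prodAssoc _ _ _).symm.comp ((MeasurePreserving.id _).prod
      ((measurePreserving_prodAssoc _ _ _).comp Measure.measurePreserving_swap))
  have hmeas : Measurable (Equiv.prodProdProdComm ℝ ℝ ℝ ℝ) :=
    (measurePreserving_prodProdProdComm (volume : Measure ℝ) (volume : Measure ℝ)
      (volume : Measure ℝ) (volume : Measure ℝ)).measurable
  have hpair := measurePreserving_duffyMap_triangle.prod measurePreserving_duffyMap_triangle
  rw [Measure.volume_eq_prod, ← Measure.prod_restrict, ← hpair.map_eq,
    ← (measurePreserving_prodProdProdComm _ _ _ _).map_eq, unitWeight_one_prod_self,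
    Measure.add_prod, Measure.map_add _ _ hmeas,
    Measure.map_add _ _ hpair.measurable]
  congr 1
  · rw [← Measure.map_id (μ := (unitWeight 0).prod (unitWeight 0)),
      Measure.map_prod_map _ _ (by fun_prop) (by fun_prop), ← hreorder.map_eq,
      Measure.map_map (by fun_prop) hreorder.measurable, Measure.map_map hmeas (by fun_prop),
      Measure.map_map hpair.measurable (by fun_prop)]
    congr 1
    ext q <;> simp [duffyPair, duffyMap]
  · rw [← Measure.prod_swap (μ := unitWeight 0) (ν := unitWeight 0),
      Measure.map_prod_map _ _ (by fun_prop) (by fun_prop), ← hreorder.map_eq,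
      Measure.map_map (by fun_prop) hreorder.measurable, Measure.map_map hmeas (by fun_prop),
      Measure.map_map hpair.measurable (by fun_prop)]
    congr 1
    ext q <;> simp [duffyPair, duffyMap]

theorem integrable_rpow_unitWeight {s : ℝ} (hs : s < 1) :
    Integrable (fun r : ℝ => r ^ (-(2 * s))) (unitWeight 3) ∧
      ∫ r, r ^ (-(2 * s)) ∂unitWeight 3 = 1 / (4 - 2 * s) := by
  have hpow : EqOn (fun r : ℝ => r ^ 3 * r ^ (-(2 * s))) (fun r => r ^ (3 - 2 * s)) (Ioc 0 1) := by
    intro r hr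
    simp only
    rw [sub_eq_add_neg, Real.rpow_add hr.1, ← Real.rpow_natCast]
    norm_num
  constructor
  · rw [integrable_unitWeight_iff, integrableOn_congr_fun hpow measurableSet_Ioc,
      ← intervalIntegrable_iff_integrableOn_Ioc_of_le zero_le_one]
    exact intervalIntegral.intervalIntegrable_rpow' (by linarith)
  · rw [integral_unitWeight, intervalIntegral.integral_congr_ae (g := fun r => r ^ (3 - 2 * s)),
      integral_rpow (Or.inl (by linarith)), Real.one_rpow, Real.zero_rpow (by linarith)]
    · congr 1 <;> ring
    · rw [uIoc_of_le zero_le_one]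
      exact Filter.Eventually.of_forall hpow

theorem integrable_of_continuousOn_unitCube {G : ℝ × ℝ × ℝ → ℝ} (hGm : Measurable G)
    (hG : ContinuousOn G (Icc 0 1 ×ˢ Icc 0 1 ×ˢ Icc 0 1)) :
    Integrable G ((unitWeight 0).prod ((unitWeight 1).prod (unitWeight 0))) := by
  obtain ⟨C, hC⟩ := (isCompact_Icc.prod
    (isCompact_Icc.prod isCompact_Icc)).exists_bound_of_continuousOn hG
  refine Integrable.of_bound hGm.aestronglyMeasurable C ?_
  filter_upwards [Measure.quasiMeasurePreserving_fst.ae (ae_unitWeight_mem 0),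
    Measure.quasiMeasurePreserving_snd.ae
      (Measure.quasiMeasurePreserving_fst.ae (ae_unitWeight_mem 1)),
    Measure.quasiMeasurePreserving_snd.ae
      (Measure.quasiMeasurePreserving_snd.ae (ae_unitWeight_mem 0))] with q h1 h2 h3
  exact hC q ⟨Ioc_subset_Icc_self h1, Ioc_subset_Icc_self h2, Ioc_subset_Icc_self h3⟩

theorem integral_unitCube {G : ℝ × ℝ × ℝ → ℝ}
    (hG : Integrable G ((unitWeight 0).prod ((unitWeight 1).prod (unitWeight 0)))) :
    ∫ q, G q ∂(unitWeight 0).prod ((unitWeight 1).prod (unitWeight 0)) =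
      ∫ c in (0 : ℝ)..1, ∫ b in (0 : ℝ)..1, ∫ a in (0 : ℝ)..1, b * G (c, b, a) := by
  have hinner : ∀ᵐ c ∂unitWeight 0,
      ∫ p, G (c, p) ∂(unitWeight 1).prod (unitWeight 0) =
        ∫ b in (0 : ℝ)..1, ∫ a in (0 : ℝ)..1, b * G (c, b, a) := by
    filter_upwards [hG.prod_right_ae] with c hc
    rw [integral_prod _ hc, integral_unitWeight]
    simp [integral_unitWeight]
  rw [integral_prod _ hG, integral_congr_ae hinner, integral_unitWeight]
  simp

/-- Duffy-transformation identity for a pair of triangles sharing exactly one vertex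
(equation (8) with c = 1, radial Duffy variable integrated out). -/
theorem duffy_common_vertex (s : ℝ) (hs : s ∈ Set.Ioo (0:ℝ) 1)
    (F : ℝ × ℝ × ℝ × ℝ × ℝ → ℝ)
    (hFcont : ContinuousOn F {w | w ≠ 0})
    (hFhom : ∀ c : ℝ, 0 < c → ∀ w, F (c • w) = c ^ (-(2*s)) * F w)
    (ψ : (ℝ × ℝ) → (ℝ × ℝ) → ℝ × ℝ × ℝ × ℝ × ℝ)
    (hψ : ∀ x y, ψ x y = (y.1 + y.2 - x.1 - x.2, x.1, x.2, -y.1, -y.2))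
    (T : Set (ℝ × ℝ))
    (hT : T = {t : ℝ × ℝ | 0 ≤ t.1 ∧ 0 ≤ t.2 ∧ t.1 + t.2 ≤ 1}) :
    IntegrableOn (fun p : (ℝ × ℝ) × (ℝ × ℝ) => F (ψ p.1 p.2)) (T ×ˢ T) volume ∧
    ∫ p in T ×ˢ T, F (ψ p.1 p.2) =
      (1 / (4 - 2*s)) *
        ∫ c in (0:ℝ)..1, ∫ b in (0:ℝ)..1, ∫ a in (0:ℝ)..1, b *
          (F (b - 1, 1 - a, a, b*c - b, -(b*c)) +
           F (1 - b, b - b*c, b*c, a - 1, -a)) := by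
  have hFm : Measurable F := measurable_of_continuousOn_compl_singleton 0 hFcont
  have hfm : Measurable fun p : (ℝ × ℝ) × (ℝ × ℝ) => F (ψ p.1 p.2) := by
    simp only [hψ]
    fun_prop
  set G₁ : ℝ × ℝ × ℝ → ℝ := fun q =>
    F (q.2.1 - 1, 1 - q.2.2, q.2.2, q.2.1 * q.1 - q.2.1, -(q.2.1 * q.1)) with hG₁
  set G₂ : ℝ × ℝ × ℝ → ℝ := fun q =>
    F (1 - q.2.1, q.2.1 - q.2.1 * q.1, q.2.1 * q.1, q.2.2 - 1, -q.2.2) with hG₂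
  have hI₁ := integrable_of_continuousOn_unitCube (G := G₁) (by fun_prop)
    (hFcont.comp (by fun_prop) fun q _ h => by
      simp only [Prod.mk_eq_zero] at h
      linarith)
  have hI₂ := integrable_of_continuousOn_unitCube (G := G₂) (by fun_prop)
    (hFcont.comp (by fun_prop) fun q _ h => by
      simp only [Prod.mk_eq_zero] at h
      linarith)
  obtain ⟨hrad, hradval⟩ := integrable_rpow_unitWeight hs.2
  set μ := (unitWeight 0).prod ((unitWeight 1).prod (unitWeight 0))
  have hpos : ∀ᵐ q ∂(unitWeight 3).prod μ, 0 < q.1 := by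
    filter_upwards [Measure.quasiMeasurePreserving_fst.ae (ae_unitWeight_mem 3)] with q hq
    exact hq.1
  have h₁ : (fun q => q.1 ^ (-(2 * s)) * G₁ q.2) =ᵐ[(unitWeight 3).prod μ]
      fun q => F (ψ (duffyPair q).1 (duffyPair q).2) := by
    filter_upwards [hpos] with q hq
    rw [hG₁, ← hFhom _ hq, hψ]
    congr 1
    simp only [duffyPair, duffyMap, Prod.smul_mk, smul_eq_mul, Prod.mk.injEq]
    refine ⟨?_, ?_, trivial, ?_, ?_⟩ <;> ring
  have h₂ : (fun q => q.1 ^ (-(2 * s)) * G₂ q.2) =ᵐ[(unitWeight 3).prod μ]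
      fun q => F (ψ (duffyPair q).2 (duffyPair q).1) := by
    filter_upwards [hpos] with q hq
    rw [hG₂, ← hFhom _ hq, hψ]
    congr 1
    simp only [duffyPair, duffyMap, Prod.smul_mk, smul_eq_mul, Prod.mk.injEq]
    refine ⟨?_, ?_, ?_, ?_, ?_⟩ <;> ring
  have hint₁ : Integrable (fun p : (ℝ × ℝ) × (ℝ × ℝ) => F (ψ p.1 p.2))
      (((unitWeight 3).prod μ).map duffyPair) :=
    (integrable_map_measure hfm.aestronglyMeasurable (by fun_prop)).2
      ((hrad.mul_prod hI₁).congr h₁)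
  have hint₂ : Integrable (fun p : (ℝ × ℝ) × (ℝ × ℝ) => F (ψ p.1 p.2))
      (((unitWeight 3).prod μ).map (Prod.swap ∘ duffyPair)) :=
    (integrable_map_measure hfm.aestronglyMeasurable (by fun_prop)).2
      ((hrad.mul_prod hI₂).congr h₂)
  rw [IntegrableOn, hT, restrict_triangle_prod_self]
  refine ⟨hint₁.add_measure hint₂, ?_⟩
  rw [integral_add_measure hint₁ hint₂, integral_map (by fun_prop) hfm.aestronglyMeasurable,
    integral_map (by fun_prop) hfm.aestronglyMeasurable, ← integral_congr_ae h₁]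
  simp only [Function.comp_apply, Prod.fst_swap, Prod.snd_swap]
  rw [← integral_congr_ae h₂, integral_prod_mul (fun r : ℝ => r ^ (-(2 * s))) G₁,
    integral_prod_mul (fun r : ℝ => r ^ (-(2 * s))) G₂, hradval, ← mul_add,
    ← integral_add hI₁ hI₂]
  exact congrArg _ (integral_unitCube (hI₁.add hI₂))
end

section
/- Let n ≥ 1 and d ≥ 1 be integers, s ∈ (0,1), α ≥ 1, h ∈ (0,1], and 0 < c ≤ C reals. Let M and A be real symmetric n×n matrices such that for all x ∈ ℝⁿ: c·h^d·‖x‖² ≤ xᵀMx ≤ C·h^d·‖x‖² and c·h^d·‖x‖² ≤ xᵀAx ≤ C·h^{d−2s}·‖x‖². Set Δt = h^{min(2, 1+2s)/(2α)}. Then M + Δt·A is positive definite and κ(M + Δt·A) ≤ (C/c) · (1 + h^{min(2, 1+2s)/(2α) − 2s}). (This is the conditioning bound for the time step Δt_{L²} chosen to balance the L² spatial error with an order-α time-stepping scheme.) -/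
open Matrix

/-- Conditioning bound for the time step Δt_{L²} = h^{min(2, 1+2s)/(2α)} balancing the
L² spatial error with an order-α time-stepping scheme. -/
theorem conditioning_L2_time_step (n d : ℕ) (hn : 1 ≤ n) (hd : 1 ≤ d)
    (s α h c C : ℝ) (hs : s ∈ Set.Ioo (0:ℝ) 1) (hα : 1 ≤ α)
    (hh : h ∈ Set.Ioc (0:ℝ) 1) (hc : 0 < c) (hcC : c ≤ C)
    (M A : Matrix (Fin n) (Fin n) ℝ) (hM : M.IsSymm) (hA : A.IsSymm)
    (hMl : ∀ x : Fin n → ℝ, c * h ^ (d:ℝ) * (x ⬝ᵥ x) ≤ x ⬝ᵥ (M *ᵥ x))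
    (hMu : ∀ x : Fin n → ℝ, x ⬝ᵥ (M *ᵥ x) ≤ C * h ^ (d:ℝ) * (x ⬝ᵥ x))
    (hAl : ∀ x : Fin n → ℝ, c * h ^ (d:ℝ) * (x ⬝ᵥ x) ≤ x ⬝ᵥ (A *ᵥ x))
    (hAu : ∀ x : Fin n → ℝ, x ⬝ᵥ (A *ᵥ x) ≤ C * h ^ ((d:ℝ) - 2*s) * (x ⬝ᵥ x))
    (Δt : ℝ) (hΔt : Δt = h ^ (min 2 (1 + 2*s) / (2*α))) :
    (M + Δt • A).PosDef ∧
    ∀ x y : Fin n → ℝ, x ≠ 0 → y ≠ 0 →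
      (x ⬝ᵥ ((M + Δt • A) *ᵥ x) / (x ⬝ᵥ x)) / (y ⬝ᵥ ((M + Δt • A) *ᵥ y) / (y ⬝ᵥ y))
        ≤ (C / c) * (1 + h ^ (min 2 (1 + 2*s) / (2*α) - 2*s)) := by
  obtain ⟨hh0, -⟩ := hh
  have hd0 : 0 < h ^ (d:ℝ) := Real.rpow_pos_of_pos hh0 _
  have hΔ0 : 0 < Δt := hΔt ▸ Real.rpow_pos_of_pos hh0 _
  have hpow : Δt * h ^ ((d:ℝ) - 2*s)
      = h ^ (d:ℝ) * h ^ (min 2 (1 + 2*s) / (2*α) - 2*s) := by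
    rw [hΔt, ← Real.rpow_add hh0, ← Real.rpow_add hh0]
    ring_nf
  have hform (x : Fin n → ℝ) :
      x ⬝ᵥ ((M + Δt • A) *ᵥ x) = x ⬝ᵥ (M *ᵥ x) + Δt * (x ⬝ᵥ (A *ᵥ x)) := by
    rw [add_mulVec, smul_mulVec, dotProduct_add, dotProduct_smul, smul_eq_mul]
  have hpos (x : Fin n → ℝ) (hx : x ≠ 0) : 0 < x ⬝ᵥ x := by
    simpa using dotProduct_star_self_pos_iff.mpr hx
  have hl (x : Fin n → ℝ) (hx : x ≠ 0) :
      c * h ^ (d:ℝ) * (x ⬝ᵥ x) ≤ x ⬝ᵥ ((M + Δt • A) *ᵥ x) := by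
    have hx0 := hpos x hx
    have hA0 : 0 ≤ x ⬝ᵥ (A *ᵥ x) := le_trans (by positivity) (hAl x)
    rw [hform]
    exact (hMl x).trans (le_add_of_nonneg_right (by positivity))
  have hu (x : Fin n → ℝ) :
      x ⬝ᵥ ((M + Δt • A) *ᵥ x)
        ≤ C * h ^ (d:ℝ) * (1 + h ^ (min 2 (1 + 2*s) / (2*α) - 2*s)) * (x ⬝ᵥ x) := by
    rw [hform]
    calc x ⬝ᵥ (M *ᵥ x) + Δt * (x ⬝ᵥ (A *ᵥ x))
        ≤ C * h ^ (d:ℝ) * (x ⬝ᵥ x) + Δt * (C * h ^ ((d:ℝ) - 2*s) * (x ⬝ᵥ x)) := by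
          gcongr
          exacts [hMu x, hAu x]
      _ = _ := by linear_combination C * (x ⬝ᵥ x) * hpow
  refine ⟨PosDef.of_dotProduct_mulVec_pos ?_ fun x hx => ?_, fun x y hx hy => ?_⟩
  · rw [IsHermitian, conjTranspose_eq_transpose_of_trivial]
    exact hM.add (hA.smul Δt)
  · have hx0 := hpos x hx
    rw [star_trivial]
    exact lt_of_lt_of_le (by positivity) (hl x hx)
  · have hC : 0 < C := hc.trans_le hcC
    have hq : 0 < h ^ (min 2 (1 + 2*s) / (2*α) - 2*s) := Real.rpow_pos_of_pos hh0 _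
    calc _ ≤ C * h ^ (d:ℝ) * (1 + h ^ (min 2 (1 + 2*s) / (2*α) - 2*s)) / (c * h ^ (d:ℝ)) :=
          div_le_div₀ (by positivity) ((div_le_iff₀ (hpos x hx)).mpr (hu x)) (by positivity)
            ((le_div_iff₀ (hpos y hy)).mpr (hl y hy))
      _ = _ := by field_simp
end

section
/- Let n ≥ 1 and d ≥ 1 be integers, s ∈ (0,1), α ≥ 1, h ∈ (0,1], and 0 < c ≤ C reals. Let M and A be real symmetric n×n matrices such that for all x ∈ ℝⁿ: c·h^d·‖x‖² ≤ xᵀMx ≤ C·h^d·‖x‖² and c·h^d·‖x‖² ≤ xᵀAx ≤ C·h^{d−2s}·‖x‖². Set Δt = h^{1/(2α)}. Then M + Δt·A is positive definite and κ(M + Δt·A) ≤ (C/c) · (1 + h^{1/(2α) − 2s}). (This is the conditioning bound for the time step Δt_{H̃ˢ} chosen to balance the energy-norm spatial error with an order-α time-stepping scheme.) -/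
open Matrix

/-- A symmetric real matrix whose quadratic form is bounded below by a positive multiple of the
squared Euclidean norm is positive definite. -/
theorem Matrix.IsSymm.posDef_of_le_dotProduct {ι : Type*} [Fintype ι] {B : Matrix ι ι ℝ}
    (hB : B.IsSymm) {a : ℝ} (ha : 0 < a)
    (hl : ∀ x : ι → ℝ, a * (x ⬝ᵥ x) ≤ x ⬝ᵥ (B *ᵥ x)) : B.PosDef := by
  refine Matrix.PosDef.of_dotProduct_mulVec_pos ?_ fun x hx => ?_
  · rw [Matrix.IsHermitian, Matrix.conjTranspose_eq_transpose_of_trivial, hB.eq]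
  · have hxx : 0 < x ⬝ᵥ x := by simpa using Matrix.dotProduct_star_self_pos_iff.2 hx
    simpa using (mul_pos ha hxx).trans_le (hl x)

/-- Two-sided bounds on the quadratic form of a real matrix bound every ratio of its Rayleigh
quotients. -/
theorem Matrix.rayleigh_div_rayleigh_le {ι : Type*} [Fintype ι] {B : Matrix ι ι ℝ} {a b : ℝ}
    (ha : 0 < a) (hl : ∀ x : ι → ℝ, a * (x ⬝ᵥ x) ≤ x ⬝ᵥ (B *ᵥ x))
    (hu : ∀ x : ι → ℝ, x ⬝ᵥ (B *ᵥ x) ≤ b * (x ⬝ᵥ x)) {x y : ι → ℝ} (hx : x ≠ 0) (hy : y ≠ 0) :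
    (x ⬝ᵥ (B *ᵥ x) / (x ⬝ᵥ x)) / (y ⬝ᵥ (B *ᵥ y) / (y ⬝ᵥ y)) ≤ b / a := by
  have hxx : 0 < x ⬝ᵥ x := by simpa using Matrix.dotProduct_star_self_pos_iff.2 hx
  have hyy : 0 < y ⬝ᵥ y := by simpa using Matrix.dotProduct_star_self_pos_iff.2 hy
  have hxb : x ⬝ᵥ (B *ᵥ x) / (x ⬝ᵥ x) ≤ b := (div_le_iff₀ hxx).2 (hu x)
  have hya : a ≤ y ⬝ᵥ (B *ᵥ y) / (y ⬝ᵥ y) := (le_div_iff₀ hyy).2 (hl y)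
  have hb : 0 ≤ b := (ha.le.trans ((le_div_iff₀ hxx).2 (hl x))).trans hxb
  exact div_le_div₀ hb hxb ha hya

/-- Conditioning bound for the time step Δt_{H̃ˢ} = h^{1/(2α)} balancing the
energy-norm spatial error with an order-α time-stepping scheme. -/
theorem conditioning_energy_time_step (n d : ℕ) (hn : 1 ≤ n) (hd : 1 ≤ d)
    (s α h c C : ℝ) (hs : s ∈ Set.Ioo (0:ℝ) 1) (hα : 1 ≤ α)
    (hh : h ∈ Set.Ioc (0:ℝ) 1) (hc : 0 < c) (hcC : c ≤ C)
    (M A : Matrix (Fin n) (Fin n) ℝ) (hM : M.IsSymm) (hA : A.IsSymm)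
    (hMl : ∀ x : Fin n → ℝ, c * h ^ (d:ℝ) * (x ⬝ᵥ x) ≤ x ⬝ᵥ (M *ᵥ x))
    (hMu : ∀ x : Fin n → ℝ, x ⬝ᵥ (M *ᵥ x) ≤ C * h ^ (d:ℝ) * (x ⬝ᵥ x))
    (hAl : ∀ x : Fin n → ℝ, c * h ^ (d:ℝ) * (x ⬝ᵥ x) ≤ x ⬝ᵥ (A *ᵥ x))
    (hAu : ∀ x : Fin n → ℝ, x ⬝ᵥ (A *ᵥ x) ≤ C * h ^ ((d:ℝ) - 2*s) * (x ⬝ᵥ x))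
    (Δt : ℝ) (hΔt : Δt = h ^ (1 / (2*α))) :
    (M + Δt • A).PosDef ∧
    ∀ x y : Fin n → ℝ, x ≠ 0 → y ≠ 0 →
      (x ⬝ᵥ ((M + Δt • A) *ᵥ x) / (x ⬝ᵥ x)) / (y ⬝ᵥ ((M + Δt • A) *ᵥ y) / (y ⬝ᵥ y))
        ≤ (C / c) * (1 + h ^ (1 / (2*α) - 2*s)) := by
  obtain ⟨hh, -⟩ := hh
  have hhd : 0 < h ^ (d:ℝ) := Real.rpow_pos_of_pos hh _
  have hΔt_pos : 0 < Δt := hΔt ▸ Real.rpow_pos_of_pos hh _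
  have hpow : Δt * h ^ ((d:ℝ) - 2*s) = h ^ (d:ℝ) * h ^ (1 / (2*α) - 2*s) := by
    rw [hΔt, ← Real.rpow_add hh, ← Real.rpow_add hh]
    ring_nf
  have hform : ∀ x : Fin n → ℝ,
      x ⬝ᵥ ((M + Δt • A) *ᵥ x) = x ⬝ᵥ (M *ᵥ x) + Δt * (x ⬝ᵥ (A *ᵥ x)) := fun x => by
    rw [add_mulVec, smul_mulVec, dotProduct_add, dotProduct_smul, smul_eq_mul]
  have ha : 0 < c * h ^ (d:ℝ) := mul_pos hc hhd
  have hl : ∀ x : Fin n → ℝ, c * h ^ (d:ℝ) * (x ⬝ᵥ x) ≤ x ⬝ᵥ ((M + Δt • A) *ᵥ x) := fun x => by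
    have hxx : 0 ≤ x ⬝ᵥ x := by simpa using dotProduct_star_self_nonneg x
    rw [hform]
    linarith [hMl x, mul_nonneg hΔt_pos.le ((mul_nonneg ha.le hxx).trans (hAl x))]
  have hu : ∀ x : Fin n → ℝ, x ⬝ᵥ ((M + Δt • A) *ᵥ x) ≤
      C * h ^ (d:ℝ) * (1 + h ^ (1 / (2*α) - 2*s)) * (x ⬝ᵥ x) := fun x => by
    rw [hform]
    calc x ⬝ᵥ (M *ᵥ x) + Δt * (x ⬝ᵥ (A *ᵥ x))
        ≤ C * h ^ (d:ℝ) * (x ⬝ᵥ x) + Δt * (C * h ^ ((d:ℝ) - 2*s) * (x ⬝ᵥ x)) :=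
          add_le_add (hMu x) (mul_le_mul_of_nonneg_left (hAu x) hΔt_pos.le)
      _ = C * h ^ (d:ℝ) * (1 + h ^ (1 / (2*α) - 2*s)) * (x ⬝ᵥ x) := by
          linear_combination C * (x ⬝ᵥ x) * hpow
  refine ⟨(hM.add (hA.smul Δt)).posDef_of_le_dotProduct ha hl, fun x y hx hy => ?_⟩
  refine (Matrix.rayleigh_div_rayleigh_le ha hl hu hx hy).trans_eq ?_
  field_simp
end

section
/- Let s ∈ (0,1), ℓ ∈ (s, 2], ρ > 1, h ∈ (0,1), and d ≥ h be real numbers. If k is a real number with k ≥ ( ((ℓ−s)/2 + 1 + s) · log(1/h) − s · log(d/h) ) / ( log(d/h) + log ρ ), then h^{−2} · d^{−2s} · (ρ · d/h)^{−2k} ≤ h^{ℓ−s}. (This is the sufficiency of the quadrature order choice, equation (18), making the non-touching volume quadrature error E_{NT} = h^{−2} d^{−2s} (ρ₂ d/h)^{−2k} of order h^{ℓ−s}, where d plays the role of the distance d_{K,K̃} between the two elements.) -/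
/-- Sufficiency of the quadrature order choice (18): the non-touching volume
quadrature error E_{NT} = h^{−2} d^{−2s} (ρ d/h)^{−2k} is of order h^{ℓ−s}. -/
theorem quadrature_order_nontouching (s ℓ ρ h d k : ℝ)
    (hs : s ∈ Set.Ioo (0:ℝ) 1) (hℓ : ℓ ∈ Set.Ioc s 2) (hρ : 1 < ρ)
    (hh : h ∈ Set.Ioo (0:ℝ) 1) (hd : h ≤ d)
    (hk : (((ℓ - s)/2 + 1 + s) * Real.log (1/h) - s * Real.log (d/h)) /
            (Real.log (d/h) + Real.log ρ) ≤ k) :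
    h ^ (-2 : ℝ) * d ^ (-(2*s)) * (ρ * d / h) ^ (-(2*k)) ≤ h ^ (ℓ - s) := by
  have hh0 : 0 < h := hh.1
  have hd0 : 0 < d := hh0.trans_le hd
  have hρ0 : 0 < ρ := one_pos.trans hρ
  have hlog : Real.log h ≤ Real.log d := Real.log_le_log hh0 hd
  have hlogρ : 0 < Real.log ρ := Real.log_pos hρ
  rw [Real.log_div hd0.ne' hh0.ne', one_div, Real.log_inv, div_le_iff₀ (by linarith)] at hk
  rw [Real.rpow_def_of_pos hh0, Real.rpow_def_of_pos hd0,
    Real.rpow_def_of_pos (by positivity : 0 < ρ * d / h), Real.rpow_def_of_pos hh0,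
    ← Real.exp_add, ← Real.exp_add, Real.exp_le_exp,
    Real.log_div (by positivity) hh0.ne', Real.log_mul hρ0.ne' hd0.ne']
  linarith
end

section
/- Let s ∈ (0,1), ℓ ∈ (s, 2], ρ > 1, h ∈ (0,1), and d ≥ h be real numbers. If k is a real number with k ≥ ( ((ℓ−s)/2 + 1/2 + s) · log(1/h) − s · log(d/h) ) / ( log(d/h) + log ρ ), then h^{−1} · d^{−2s} · (ρ · d/h)^{−2k} ≤ h^{ℓ−s}. (This is the sufficiency of the quadrature order choice, equation (20), making the non-touching element–boundary-edge quadrature error E_{NT,∂} = h^{−1} d^{−2s} (ρ₄ d/h)^{−2k} of order h^{ℓ−s}, where d plays the role of the distance d_{K,e}.) -/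
/-- Sufficiency of the quadrature order choice (20): the non-touching
element–boundary-edge quadrature error E_{NT,∂} = h^{−1} d^{−2s} (ρ d/h)^{−2k}
is of order h^{ℓ−s}. -/
theorem quadrature_order_nontouching_boundary (s ℓ ρ h d k : ℝ)
    (hs : s ∈ Set.Ioo (0:ℝ) 1) (hℓ : ℓ ∈ Set.Ioc s 2) (hρ : 1 < ρ)
    (hh : h ∈ Set.Ioo (0:ℝ) 1) (hd : h ≤ d)
    (hk : (((ℓ - s)/2 + 1/2 + s) * Real.log (1/h) - s * Real.log (d/h)) /
            (Real.log (d/h) + Real.log ρ) ≤ k) :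
    h ^ (-1 : ℝ) * d ^ (-(2*s)) * (ρ * d / h) ^ (-(2*k)) ≤ h ^ (ℓ - s) := by
  obtain ⟨h_pos, -⟩ := hh
  have d_pos : 0 < d := h_pos.trans_le hd
  have ρ_pos : 0 < ρ := one_pos.trans hρ
  have log_ρ_pos : 0 < Real.log ρ := Real.log_pos hρ
  have log_h_le : Real.log h ≤ Real.log d := Real.log_le_log h_pos hd
  rw [Real.log_div d_pos.ne' h_pos.ne', one_div h, Real.log_inv,
    div_le_iff₀ (by linarith)] at hk
  rw [← Real.log_le_log_iff (by positivity) (by positivity),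
    Real.log_mul (by positivity) (by positivity), Real.log_mul (by positivity) (by positivity),
    Real.log_rpow h_pos, Real.log_rpow d_pos, Real.log_rpow (by positivity),
    Real.log_rpow h_pos, Real.log_div (by positivity) h_pos.ne',
    Real.log_mul ρ_pos.ne' d_pos.ne']
  linarith
end

section
/- Let d ≥ 1 be an integer, s ∈ (0,1), D > 0, and let u : ℝ^d → ℝ be a measurable square-integrable function such that ‖x − y‖ ≤ D for all x, y in the set {z : u(z) ≠ 0} (in particular u vanishes outside a set of diameter at most D). Then, as an inequality of (possibly infinite) integrals of nonnegative functions, (d · ω_d / s) · D^{−2s} · ∫_{ℝ^d} u(x)² dx ≤ ∫_{ℝ^d}∫_{ℝ^d} (u(x) − u(y))² · K_s(x,y) dy dx, where ω_d is the Lebesgue volume of the unit ball in ℝ^d. (This is the fractional Poincaré inequality ‖u‖_{L²(Ω)} ≤ C ‖u‖_{H̃ˢ(Ω)} used in the Strang-lemma argument, with an explicit constant in terms of the diameter of Ω.) -/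
open MeasureTheory

section RadialTail

variable {E : Type*} [NormedAddCommGroup E] [NormedSpace ℝ E] [MeasurableSpace E] [BorelSpace E]
  [FiniteDimensional ℝ E] [Nontrivial E] (μ : Measure E) [μ.IsAddHaarMeasure]

/-- The integral of `‖z‖ ^ (-(dim E + a))` over the complement of a closed ball of radius `D`. -/
theorem lintegral_indicator_Ioi_rpow_norm {a D : ℝ} (ha : 0 < a) (hD : 0 < D) :
    ∫⁻ z, ENNReal.ofReal ((Set.Ioi D).indicator
        (fun r : ℝ => r ^ (-((Module.finrank ℝ E : ℝ) + a))) ‖z‖) ∂μ =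
      ENNReal.ofReal (Module.finrank ℝ E * μ.real (Metric.ball 0 1) * (D ^ (-a) / a)) := by
  set n := Module.finrank ℝ E
  have hn1 : 1 ≤ n := Module.finrank_pos
  set f : ℝ → ℝ := (Set.Ioi D).indicator (fun r : ℝ => r ^ (-((n : ℝ) + a)))
  have hf : Set.EqOn (fun y : ℝ => y ^ (n - 1) • f y)
      ((Set.Ioi D).indicator fun y : ℝ => y ^ (-a - 1)) (Set.Ioi 0) := by
    intro y hy
    by_cases hyD : y ∈ Set.Ioi D
    · simp only [f, Set.indicator_of_mem hyD, smul_eq_mul]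
      rw [← Real.rpow_natCast, ← Real.rpow_add hy, Nat.cast_sub hn1]
      congr 1
      push_cast
      ring
    · simp [f, Set.indicator_of_notMem hyD]
  have hsub : Set.Ioi (0 : ℝ) ∩ Set.Ioi D = Set.Ioi D :=
    Set.inter_eq_right.2 (Set.Ioi_subset_Ioi hD.le)
  have hint : Integrable (fun z => f ‖z‖) μ := by
    rw [integrable_fun_norm_addHaar, integrableOn_congr_fun hf measurableSet_Ioi]
    exact ((integrable_indicator_iff measurableSet_Ioi).2
      (integrableOn_Ioi_rpow_of_lt (by linarith) hD)).integrableOn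
  rw [← ofReal_integral_eq_lintegral_ofReal hint (Filter.Eventually.of_forall fun z =>
      Set.indicator_nonneg (fun r hr => Real.rpow_nonneg (hD.trans hr).le _) _),
    integral_fun_norm_addHaar, setIntegral_congr_fun measurableSet_Ioi hf,
    setIntegral_indicator measurableSet_Ioi, hsub,
    integral_Ioi_rpow_of_lt (by linarith) hD, nsmul_eq_mul, smul_eq_mul, sub_add_cancel,
    neg_div_neg_eq, mul_assoc]

end RadialTail

/-- Fractional Poincaré inequality with explicit constant: if u vanishes outside a set of
diameter at most D, then (d ω_d / s) D^{−2s} ‖u‖²_{L²} is bounded by the Gagliardo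
double integral, as an inequality of (possibly infinite) integrals of nonnegative
functions. -/
theorem fractional_poincare (d : ℕ) (hd : 1 ≤ d) (s D : ℝ)
    (hs : s ∈ Set.Ioo (0:ℝ) 1) (hD : 0 < D)
    (u : EuclideanSpace ℝ (Fin d) → ℝ) (hu : Measurable u)
    (hu2 : Integrable (fun x => (u x) ^ 2) volume)
    (hsupp : ∀ x y : EuclideanSpace ℝ (Fin d), u x ≠ 0 → u y ≠ 0 → ‖x - y‖ ≤ D) :
    ENNReal.ofReal
        (((d:ℝ) * (volume (Metric.closedBall (0 : EuclideanSpace ℝ (Fin d)) 1)).toReal / s)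
          * D ^ (-(2*s)))
      * (∫⁻ x : EuclideanSpace ℝ (Fin d), ENNReal.ofReal ((u x) ^ 2)) ≤
    ∫⁻ p : EuclideanSpace ℝ (Fin d) × EuclideanSpace ℝ (Fin d),
      ENNReal.ofReal ((u p.1 - u p.2) ^ 2 * ‖p.1 - p.2‖ ^ (-((d:ℝ) + 2*s))) := by
  have hs0 : 0 < s := hs.1
  have : Nontrivial (EuclideanSpace ℝ (Fin d)) :=
    Module.nontrivial_of_finrank_pos (R := ℝ) (by rwa [finrank_euclideanSpace_fin])
  set k : EuclideanSpace ℝ (Fin d) → ℝ := fun z =>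
    (Set.Ioi D).indicator (fun r : ℝ => r ^ (-((d : ℝ) + 2 * s))) ‖z‖ with hk
  have hk_meas : Measurable k :=
    (Measurable.indicator (by fun_prop) measurableSet_Ioi).comp measurable_norm
  have hk_int := lintegral_indicator_Ioi_rpow_norm
    (volume : Measure (EuclideanSpace ℝ (Fin d))) (a := 2 * s) (by linarith) hD
  rw [finrank_euclideanSpace_fin] at hk_int
  set F : EuclideanSpace ℝ (Fin d) × EuclideanSpace ℝ (Fin d) → ENNReal := fun p =>
    ENNReal.ofReal (u p.1 ^ 2) * ENNReal.ofReal (k (p.1 - p.2)) with hF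
  have hF_meas : Measurable F := by fun_prop
  have hF_int : ∫⁻ p, F p = (∫⁻ x, ENNReal.ofReal (u x ^ 2)) * ∫⁻ z, ENNReal.ofReal (k z) := by
    rw [Measure.volume_eq_prod, lintegral_prod _ hF_meas.aemeasurable,
      ← lintegral_mul_const _ (by fun_prop)]
    refine lintegral_congr fun x => ?_
    simp only [hF]
    rw [lintegral_const_mul _ (by fun_prop),
      lintegral_sub_left_eq_self (fun z => ENNReal.ofReal (k z)) x]
  have hF_swap : ∫⁻ p, F (Prod.swap p) = ∫⁻ p, F p := lintegral_prod_swap F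
  have hball : volume.real (Metric.ball (0 : EuclideanSpace ℝ (Fin d)) 1) =
      (volume (Metric.closedBall (0 : EuclideanSpace ℝ (Fin d)) 1)).toReal := by
    rw [Measure.real, Measure.addHaar_closedBall_eq_addHaar_ball]
  calc
    _ = ∫⁻ p, (F p + F (Prod.swap p)) := by
      rw [lintegral_add_left hF_meas, hF_swap, hF_int, hk_int, hball, ← mul_add,
        ← ENNReal.ofReal_add (by positivity) (by positivity), mul_comm]
      congr 2
      field_simp
      norm_num
    _ ≤ _ := by
      refine lintegral_mono fun ⟨x, y⟩ => ?_
      simp only [hF, Prod.swap, norm_sub_rev y x, hk]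
      by_cases h : ‖x - y‖ ∈ Set.Ioi D
      · rw [Set.indicator_of_mem h, ← add_mul, ← ENNReal.ofReal_add (by positivity) (by positivity),
          ← ENNReal.ofReal_mul (by positivity)]
        have hxy : u x = 0 ∨ u y = 0 := by
          by_contra! hne
          exact (hsupp x y hne.1 hne.2).not_gt h
        apply le_of_eq
        congr 2
        rcases hxy with h0 | h0 <;> simp [h0]
      · simp [Set.indicator_of_notMem h]
end
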